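/- arXiv:2512.06398 — 3 statements merged into one kernel-verified Lean document; each statement's English description precedes it below -/
import Mathlib

section
/- Let 1 ≤ p < q < ∞ with α := 1/p − 1/q < 1, and let g be analytic on 𝔻 with (1−|z|)^{1−α}|g'(z)| → 0 as |z| → 1⁻ (i.e. g belongs to the little Lipschitz space λ_α). Then there exists an analytic f on 𝔻 such that f ∉ H^p but V_g f ∈ H^q; that is, H^p is a proper subspace of [V_g, H^q]. -/
open Metric Real

/-- The generalized Volterra operator `(V_g f)(z) = ∫₀ᶻ f(ξ)g'(ξ)dξ = z·∫₀¹ f(sz)g'(sz) ds`. -/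
noncomputable def Vg (g f : ℂ → ℂ) (z : ℂ) : ℂ :=
  z * ∫ s in (0:ℝ)..1, f ((s : ℂ) * z) * deriv g ((s : ℂ) * z)

/-- `f` belongs to the Hardy space `H^p`: `sup_{0≤r<1} ∫₀^{2π} |f(r e^{iθ})|^p dθ < ∞`. -/
def memHp (p : ℝ) (f : ℂ → ℂ) : Prop :=
  ∃ C : ℝ, ∀ r ∈ Set.Ico (0:ℝ) 1,
    (∫ θ in (0:ℝ)..(2 * π),
      ‖f ((r : ℂ) * Complex.exp ((θ : ℂ) * Complex.I))‖ ^ p) ≤ C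

open MeasureTheory Set Filter Topology
open scoped ENNReal

lemma integral_poissonKernel_smul_circleMap {f : ℂ → ℂ} {R : ℝ} {w : ℂ}
    (hf : DiffContOnCl ℂ f (ball 0 R)) (hw : w ∈ ball (0 : ℂ) R) :
    ∫ θ in (0:ℝ)..(2 * π), poissonKernel 0 w (circleMap 0 R θ) • f (circleMap 0 R θ)
      = (2 * π) • f w := by
  have h := hf.circleAverage_poissonKernel_smul hw
  rw [circleAverage_def] at h
  rw [← h, smul_smul, mul_inv_cancel₀ (by positivity), one_smul]
  rfl

lemma integral_poissonKernel_circleMap {R : ℝ} {w : ℂ} (hw : w ∈ ball (0 : ℂ) R) :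
    ∫ θ in (0:ℝ)..(2 * π), poissonKernel 0 w (circleMap 0 R θ) = 2 * π := by
  have h := integral_poissonKernel_smul_circleMap (f := fun _ ↦ 1) diffContOnCl_const hw
  have h2 : ∀ θ : ℝ, poissonKernel 0 w (circleMap 0 R θ) • (1 : ℂ)
      = ((poissonKernel 0 w (circleMap 0 R θ) : ℝ) : ℂ) := fun θ ↦ by simp
  simp only [h2, intervalIntegral.integral_ofReal] at h
  have h3 := congrArg Complex.re h
  simpa using h3

lemma continuous_poissonKernel_circleMap {R : ℝ} {w : ℂ} (hw : w ∈ ball (0 : ℂ) R) :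
    Continuous fun θ ↦ poissonKernel 0 w (circleMap 0 R θ) := by
  have hne : ∀ θ, circleMap 0 R θ - w ≠ 0 := fun θ ↦ sub_ne_zero.2 (circleMap_ne_mem_ball hw θ)
  simp only [poissonKernel_def, sub_zero]
  refine Continuous.div (by fun_prop) (by fun_prop) fun θ ↦ ?_
  exact pow_ne_zero _ (norm_ne_zero_iff.2 (hne θ))

lemma poissonKernel_circleMap_bounds {x : ℝ} (hx0 : 0 < x) (hx1 : x < 1) (θ : ℝ) :
    0 ≤ poissonKernel 0 ((x ^ 2 : ℝ) : ℂ) (circleMap 0 x θ) ∧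
      poissonKernel 0 ((x ^ 2 : ℝ) : ℂ) (circleMap 0 x θ) ≤ 2 / (1 - x) := by
  have hz : ‖circleMap 0 x θ‖ = x := by simp [abs_of_pos hx0]
  have hw : ‖((x ^ 2 : ℝ) : ℂ)‖ = x ^ 2 := by
    rw [Complex.norm_real, Real.norm_of_nonneg (by positivity)]
  have hd : x - x ^ 2 ≤ ‖circleMap 0 x θ - ((x ^ 2 : ℝ) : ℂ)‖ := by
    have := norm_sub_norm_le (circleMap 0 x θ) ((x ^ 2 : ℝ) : ℂ)
    rwa [hz, hw] at this
  have hpos : 0 < x - x ^ 2 := by nlinarith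
  have hδ : 0 < 1 - x := by linarith
  rw [poissonKernel_def]
  simp only [sub_zero]
  rw [hz, hw]
  have hnum : 0 ≤ x ^ 2 - (x ^ 2) ^ 2 := by nlinarith [mul_pos hx0 hpos]
  refine ⟨by positivity, ?_⟩
  calc _ ≤ (x ^ 2 - (x ^ 2) ^ 2) / (x - x ^ 2) ^ 2 := by gcongr
    _ = (1 + x) / (1 - x) := by
      have : x - x ^ 2 = x * (1 - x) := by ring
      rw [this]; field_simp; ring
    _ ≤ _ := by gcongr; linarith

/-- Functions in `H^p` grow at most like `(1 - |z|)^(-1/p)`. -/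
lemma memHp.norm_le {p : ℝ} (hp : 1 ≤ p) {f : ℂ → ℂ} (hf : DifferentiableOn ℂ f (ball 0 1))
    (h : memHp p f) :
    ∃ K : ℝ, ∀ x : ℝ, 0 < x → x < 1 → ‖f ((x ^ 2 : ℝ) : ℂ)‖ ≤ K * (1 - x) ^ (-(1 / p)) := by
  obtain ⟨C, hC⟩ := h
  refine ⟨1 + C / π, fun x hx0 hx1 ↦ ?_⟩
  have hδ : 0 < 1 - x := by linarith
  set L : ℝ := (1 - x) ^ (-(1 / p)) with hL
  have hLpos : 0 < L := by positivity
  have hw : ((x ^ 2 : ℝ) : ℂ) ∈ ball (0 : ℂ) x := by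
    rw [mem_ball_zero_iff, Complex.norm_real, Real.norm_of_nonneg (by positivity)]
    nlinarith
  have hsub : closedBall (0 : ℂ) x ⊆ ball 0 1 := closedBall_subset_ball hx1
  have hdc : DiffContOnCl ℂ f (ball 0 x) :=
    (hf.mono (closure_ball_subset_closedBall.trans hsub)).diffContOnCl
  have hmem : ∀ θ, circleMap 0 x θ ∈ ball (0 : ℂ) 1 := fun θ ↦
    hsub (circleMap_mem_closedBall 0 hx0.le θ)
  have hcf : Continuous fun θ ↦ f (circleMap 0 x θ) :=
    hf.continuousOn.comp_continuous (by fun_prop) hmem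
  have hcp : Continuous fun θ ↦ ‖f (circleMap 0 x θ)‖ ^ p :=
    hcf.norm.rpow_const fun θ ↦ Or.inr (by linarith)
  have hcP := continuous_poissonKernel_circleMap hw
  set P : ℝ → ℝ := fun θ ↦ poissonKernel 0 ((x ^ 2 : ℝ) : ℂ) (circleMap 0 x θ) with hP
  have hPb : ∀ θ, 0 ≤ P θ ∧ P θ ≤ 2 / (1 - x) := poissonKernel_circleMap_bounds hx0 hx1
  have hpt : ∀ θ, ‖P θ • f (circleMap 0 x θ)‖ ≤
      P θ * L + 2 / (1 - x) * L ^ (1 - p) * ‖f (circleMap 0 x θ)‖ ^ p := by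
    intro θ
    rw [norm_smul, Real.norm_of_nonneg (hPb θ).1]
    set y := ‖f (circleMap 0 x θ)‖
    have hy : 0 ≤ y := norm_nonneg _
    have key : y ≤ L + L ^ (1 - p) * y ^ p := by
      rcases le_total y L with hyL | hyL
      · have : 0 ≤ L ^ (1 - p) * y ^ p := by positivity
        linarith
      · have hy0 : 0 < y := hLpos.trans_le hyL
        have h1 : y ^ (1 - p) ≤ L ^ (1 - p) :=
          Real.rpow_le_rpow_of_nonpos hLpos hyL (by linarith)
        calc y = y ^ (1 - p) * y ^ p := by
              rw [← Real.rpow_add hy0]; simp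
          _ ≤ L ^ (1 - p) * y ^ p := by gcongr
          _ ≤ _ := by linarith
    calc P θ * y ≤ P θ * (L + L ^ (1 - p) * y ^ p) := by
          gcongr; exact (hPb θ).1
      _ = P θ * L + P θ * (L ^ (1 - p) * y ^ p) := by ring
      _ ≤ P θ * L + 2 / (1 - x) * (L ^ (1 - p) * y ^ p) := by
          gcongr; exact (hPb θ).2
      _ = _ := by ring
  have hint := integral_poissonKernel_smul_circleMap hdc hw
  have h1 : 2 * π * ‖f ((x ^ 2 : ℝ) : ℂ)‖ ≤
      2 * π * L + 2 / (1 - x) * L ^ (1 - p) * C := by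
    calc 2 * π * ‖f ((x ^ 2 : ℝ) : ℂ)‖ = ‖(2 * π) • f ((x ^ 2 : ℝ) : ℂ)‖ := by
          rw [norm_smul, Real.norm_of_nonneg (by positivity)]
      _ = ‖∫ θ in (0:ℝ)..(2 * π), P θ • f (circleMap 0 x θ)‖ := by rw [hint]
      _ ≤ ∫ θ in (0:ℝ)..(2 * π), ‖P θ • f (circleMap 0 x θ)‖ :=
          intervalIntegral.norm_integral_le_integral_norm (by positivity)
      _ ≤ ∫ θ in (0:ℝ)..(2 * π),
          (P θ * L + 2 / (1 - x) * L ^ (1 - p) * ‖f (circleMap 0 x θ)‖ ^ p) := by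
          refine intervalIntegral.integral_mono_on (by positivity)
            ((hcP.smul hcf).norm.intervalIntegrable _ _)
            (Continuous.intervalIntegrable (by fun_prop) _ _) fun θ _ ↦ hpt θ
      _ = 2 * π * L + 2 / (1 - x) * L ^ (1 - p) *
          ∫ θ in (0:ℝ)..(2 * π), ‖f (circleMap 0 x θ)‖ ^ p := by
          rw [intervalIntegral.integral_add (Continuous.intervalIntegrable (by fun_prop) _ _)
            (Continuous.intervalIntegrable (by fun_prop) _ _),
            intervalIntegral.integral_mul_const, intervalIntegral.integral_const_mul,
            integral_poissonKernel_circleMap hw]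
      _ ≤ _ := by
          gcongr
          have := hC x ⟨hx0.le, hx1⟩
          simpa [circleMap] using this
  have h2 : L ^ (1 - p) = (1 - x) * L := by
    rw [hL, ← Real.rpow_mul hδ.le]
    nth_rewrite 2 [← Real.rpow_one (1 - x)]
    rw [← Real.rpow_add hδ]
    congr 1
    have : p ≠ 0 := by linarith
    field_simp; ring
  have h3 : 2 / (1 - x) * L ^ (1 - p) * C = 2 * π * (C / π * L) := by
    rw [h2]; field_simp
  rw [h3] at h1
  have : 0 < 2 * π := by positivity
  nlinarith

lemma lintegral_inv_norm_sq_le {x : ℝ} (hx0 : 0 ≤ x) (hx1 : x < 1) :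
    ∫⁻ θ in Ioc 0 (2 * π), ENNReal.ofReal
      (‖1 - (x : ℂ) * Complex.exp ((θ : ℂ) * Complex.I)‖ ^ (-2 : ℝ)) ≤
      ENNReal.ofReal (2 * π / (1 - x)) := by
  have hw : (x : ℂ) ∈ ball (0 : ℂ) 1 := by simpa [abs_of_nonneg hx0] using hx1
  have hδ : 0 < 1 - x := by linarith
  have hpt : ∀ θ : ℝ, ‖1 - (x : ℂ) * Complex.exp ((θ : ℂ) * Complex.I)‖ ^ (-2 : ℝ)
      = (1 - x ^ 2)⁻¹ * poissonKernel 0 x (circleMap 0 1 θ) := by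
    intro θ
    have hn : ‖circleMap 0 1 θ - (x : ℂ)‖
        = ‖1 - (x : ℂ) * Complex.exp ((θ : ℂ) * Complex.I)‖ := by
      have h1 : circleMap 0 1 θ - (x : ℂ) = Complex.exp ((θ : ℂ) * Complex.I) *
          (starRingEnd ℂ) (1 - (x : ℂ) * Complex.exp ((θ : ℂ) * Complex.I)) := by
        simp only [circleMap, map_sub, map_mul, map_one, ← Complex.exp_conj, Complex.conj_ofReal,
          Complex.conj_I, mul_sub, mul_one, mul_neg]
        rw [mul_left_comm, ← Complex.exp_add]
        simp
      rw [h1, norm_mul, Complex.norm_exp_ofReal_mul_I, one_mul, Complex.norm_conj]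
    have h1x : 1 - x ^ 2 ≠ 0 := by nlinarith
    simp only [poissonKernel_def, sub_zero]
    rw [hn, Real.rpow_neg (norm_nonneg _)]
    simp [abs_of_nonneg hx0]
    field_simp
  simp only [hpt]
  have hcP := continuous_poissonKernel_circleMap hw
  have hPnn : ∀ θ, 0 ≤ (1 - x ^ 2)⁻¹ * poissonKernel 0 x (circleMap 0 1 θ) := fun θ ↦ by
    rw [← hpt]; positivity
  rw [← ofReal_integral_eq_lintegral_ofReal _ (Eventually.of_forall hPnn)]
  · refine ENNReal.ofReal_le_ofReal ?_
    rw [← intervalIntegral.integral_of_le (by positivity), intervalIntegral.integral_const_mul,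
      integral_poissonKernel_circleMap hw, inv_mul_eq_div]
    gcongr
    nlinarith
  · exact (Continuous.integrableOn_Icc (by fun_prop)).mono_set Ioc_subset_Icc_self

lemma lintegral_radial_le {a v : ℝ} (ha : 0 < a) (hv : 0 < v) :
    ∫⁻ s in Ioc (0 : ℝ) 1, ENNReal.ofReal
      (((1 - s) / (v + (1 - s))) ^ (a - 1) * (v / (v + (1 - s)) ^ 2)) ≤
      ENNReal.ofReal (1 / a) := by
  set Φ : ℝ → ℝ := fun s ↦ -(((1 - s) / (v + (1 - s))) ^ a) / a
  have hden : ∀ s ∈ Icc (0 : ℝ) 1, 0 < v + (1 - s) := fun s hs ↦ by linarith [hs.2]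
  have hcont : ContinuousOn Φ (Icc 0 1) := by
    refine ContinuousOn.div_const (ContinuousOn.neg (ContinuousOn.rpow_const ?_ ?_)) _
    · exact ContinuousOn.div (by fun_prop) (by fun_prop) fun s hs ↦ (hden s hs).ne'
    · exact fun s hs ↦ Or.inr ha.le
  have hderiv : ∀ s ∈ Ioo (0 : ℝ) 1, HasDerivAt Φ
      (((1 - s) / (v + (1 - s))) ^ (a - 1) * (v / (v + (1 - s)) ^ 2)) s := by
    intro s hs
    have hd := hden s (Ioo_subset_Icc_self hs)
    have h1 : HasDerivAt (fun s : ℝ ↦ 1 - s) (-1) s := by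
      simpa using (hasDerivAt_id s).const_sub 1
    have h2 := h1.div (h1.const_add v) hd.ne'
    have hq : 0 < (1 - s) / (v + (1 - s)) := div_pos (by linarith [hs.2]) hd
    have h3 := ((h2.rpow_const (p := a) (Or.inl hq.ne')).neg).div_const a
    refine h3.congr_deriv ?_
    simp only [Pi.div_apply]
    field_simp
    ring
  have hnn : ∀ s ∈ Ioc (0 : ℝ) 1,
      0 ≤ ((1 - s) / (v + (1 - s))) ^ (a - 1) * (v / (v + (1 - s)) ^ 2) := by
    intro s hs
    have hd := hden s (Ioc_subset_Icc_self hs)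
    have : 0 ≤ 1 - s := by linarith [hs.2]
    positivity
  have hint := intervalIntegral.integrableOn_deriv_of_nonneg hcont hderiv
    fun s hs ↦ hnn s (Ioo_subset_Ioc_self hs)
  rw [← ofReal_integral_eq_lintegral_ofReal hint
    ((ae_restrict_iff' measurableSet_Ioc).2 (Eventually.of_forall hnn))]
  refine ENNReal.ofReal_le_ofReal ?_
  rw [← intervalIntegral.integral_of_le zero_le_one,
    intervalIntegral.integral_eq_sub_of_hasDerivAt_of_le zero_le_one hcont hderiv
      ((intervalIntegrable_iff_integrableOn_Ioc_of_le zero_le_one).2 hint)]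
  have h0 : ((1:ℝ) / (v + 1)) ^ a ≤ 1 :=
    Real.rpow_le_one (by positivity) (by rw [div_le_one (by positivity)]; linarith) ha.le
  simp only [Φ, sub_self, zero_div, Real.zero_rpow ha.ne', sub_zero, neg_zero]
  rw [zero_sub, ← neg_div, neg_neg]
  gcongr

lemma lintegral_weight_le {a w : ℝ} (ha : 0 < a) (ha1 : a ≤ 1) (hw : 0 < w) {h : ℝ → ℝ}
    (h1 : ∀ s ∈ Ioc (0 : ℝ) 1, w / 2 ≤ h s) (h2 : ∀ s ∈ Ioc (0 : ℝ) 1, 1 - s ≤ h s) :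
    ∫⁻ s in Ioc (0 : ℝ) 1, ENNReal.ofReal ((1 - s) ^ (a - 1) * (h s ^ 4)⁻¹) ≤
      ENNReal.ofReal (256 / a * w ^ (a - 4)) := by
  set v := w / 2 with hvdef
  have hv : 0 < v := by positivity
  calc
    _ ≤ ∫⁻ s in Ioc (0 : ℝ) 1, ENNReal.ofReal (16 * v ^ (a - 4)) * ENNReal.ofReal
      (((1 - s) / (v + (1 - s))) ^ (a - 1) * (v / (v + (1 - s)) ^ 2)) := by
        refine lintegral_mono_ae ((ae_restrict_iff' measurableSet_Ioc).2
          (Eventually.of_forall fun s hs ↦ ?_))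
        have hx : 0 ≤ 1 - s := by linarith [hs.2]
        rw [← ENNReal.ofReal_mul (by positivity)]
        refine ENNReal.ofReal_le_ofReal ?_
        have hsum : (v + (1 - s)) / 2 ≤ h s := by linarith [h1 s hs, h2 s hs]
        set d := v + (1 - s) with hd
        have hd0 : 0 < d := by positivity
        have hvd : v ≤ d := by linarith
        have e1 : v ^ (a - 4) * v = v ^ (a - 3) := by
          nth_rewrite 2 [← Real.rpow_one v]
          rw [← Real.rpow_add hv]; ring_nf
        have e2 : d ^ (a - 3) ≤ v ^ (a - 3) :=
          Real.rpow_le_rpow_of_nonpos hv hvd (by linarith)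
        have e3 : (d ^ 4)⁻¹ * d ^ (a - 1) = d ^ (a - 3) * (d ^ 2)⁻¹ := by
          rw [← Real.rpow_natCast, ← Real.rpow_natCast, ← Real.rpow_neg hd0.le,
            ← Real.rpow_neg hd0.le, ← Real.rpow_add hd0, ← Real.rpow_add hd0]
          congr 1; push_cast; ring
        have hpow : 0 < d ^ (a - 1) := by positivity
        calc (1 - s) ^ (a - 1) * (h s ^ 4)⁻¹ ≤ (1 - s) ^ (a - 1) * ((d / 2) ^ 4)⁻¹ := by
              gcongr
          _ = 16 * (((1 - s) ^ (a - 1) / d ^ (a - 1)) * ((d ^ 4)⁻¹ * d ^ (a - 1))) := by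
              field_simp; norm_num
          _ = 16 * (((1 - s) ^ (a - 1) / d ^ (a - 1)) * (d ^ (a - 3) * (d ^ 2)⁻¹)) := by rw [e3]
          _ ≤ 16 * (((1 - s) ^ (a - 1) / d ^ (a - 1)) * (v ^ (a - 3) * (d ^ 2)⁻¹)) := by gcongr
          _ = _ := by
              rw [← e1, Real.div_rpow hx hd0.le]; ring
    _ = ENNReal.ofReal (16 * v ^ (a - 4)) * ∫⁻ s in Ioc (0 : ℝ) 1, ENNReal.ofReal
      (((1 - s) / (v + (1 - s))) ^ (a - 1) * (v / (v + (1 - s)) ^ 2)) := by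
        rw [lintegral_const_mul' _ _ ENNReal.ofReal_ne_top]
    _ ≤ ENNReal.ofReal (16 * v ^ (a - 4)) * ENNReal.ofReal (1 / a) := by
        gcongr; exact lintegral_radial_le ha hv
    _ ≤ _ := by
        rw [← ENNReal.ofReal_mul (by positivity)]
        refine ENNReal.ofReal_le_ofReal ?_
        have : v ^ (a - 4) ≤ 16 * w ^ (a - 4) := by
          rw [hvdef, div_eq_mul_inv, Real.mul_rpow hw.le (by positivity), mul_comm,
            Real.inv_rpow (by norm_num), ← Real.rpow_neg (by norm_num)]
          gcongr
          calc (2:ℝ) ^ (-(a - 4)) ≤ 2 ^ (4:ℝ) :=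
                Real.rpow_le_rpow_of_exponent_le (by norm_num) (by linarith)
            _ = 16 := by norm_num
        calc 16 * v ^ (a - 4) * (1 / a) ≤ 16 * (16 * w ^ (a - 4)) * (1 / a) := by gcongr
          _ = _ := by ring

lemma exists_norm_deriv_le {α : ℝ} {g : ℂ → ℂ} (hg : DifferentiableOn ℂ g (ball (0:ℂ) 1))
    (hlam : ∀ ε > (0:ℝ), ∃ r < (1:ℝ), ∀ z ∈ ball (0:ℂ) 1, r < ‖z‖ →
      (1 - ‖z‖) ^ (1 - α) * ‖deriv g z‖ < ε) {ε : ℝ} (hε : 0 < ε) :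
    ∃ M : ℝ, 0 ≤ M ∧ ∀ z ∈ ball (0:ℂ) 1, ‖deriv g z‖ ≤ M + ε * (1 - ‖z‖) ^ (α - 1) := by
  obtain ⟨r, hr, h⟩ := hlam ε hε
  have hc : ContinuousOn (deriv g) (closedBall 0 r) :=
    (hg.deriv isOpen_ball).continuousOn.mono (closedBall_subset_ball hr)
  obtain ⟨M, hM⟩ := (isCompact_closedBall (0:ℂ) r).exists_bound_of_continuousOn hc
  refine ⟨max M 0, le_max_right _ _, fun z hz ↦ ?_⟩
  have hz1 : 0 < 1 - ‖z‖ := by simpa using hz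
  have hpos : 0 < (1 - ‖z‖) ^ (α - 1) := by positivity
  rcases le_or_gt ‖z‖ r with hzr | hzr
  · have := hM z (by simpa using hzr)
    have := le_max_left M 0
    have : 0 < ε * (1 - ‖z‖) ^ (α - 1) := by positivity
    linarith
  · have h1 := h z hz hzr
    have h2 : (1 - ‖z‖) ^ (α - 1) * (1 - ‖z‖) ^ (1 - α) = 1 := by
      rw [← Real.rpow_add hz1]; simp
    have h3 : ‖deriv g z‖ ≤ ε * (1 - ‖z‖) ^ (α - 1) :=
      calc ‖deriv g z‖ = (1 - ‖z‖) ^ (α - 1) * ((1 - ‖z‖) ^ (1 - α) * ‖deriv g z‖) := by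
            rw [← mul_assoc, h2, one_mul]
        _ ≤ (1 - ‖z‖) ^ (α - 1) * ε := by gcongr
        _ = _ := mul_comm _ _
    have := le_max_right M 0
    linarith

/-- Test function with a peak at scale `δ` near the boundary point `1`, of bounded `H^p` norm. -/
noncomputable def bump (p δ : ℝ) (z : ℂ) : ℂ :=
  ((δ ^ (4 - 1 / p) : ℝ) : ℂ) * ((1 - ((1 - δ : ℝ) : ℂ) * z) ^ 4)⁻¹

lemma norm_one_sub_le (ρ : ℝ) (hρ0 : 0 ≤ ρ) (hρ1 : ρ ≤ 1) {a : ℂ} (ha : ‖a‖ ≤ 1) :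
    ‖1 - a‖ / 2 ≤ ‖1 - (ρ : ℂ) * a‖ := by
  have h1 : ‖1 - a‖ ≤ ‖1 - (ρ : ℂ) * a‖ + (1 - ρ) * ‖a‖ := by
    have : 1 - a = (1 - (ρ : ℂ) * a) - ((1 - ρ : ℝ) : ℂ) * a := by push_cast; ring
    rw [this]
    refine (norm_sub_le _ _).trans ?_
    rw [norm_mul, Complex.norm_real, Real.norm_of_nonneg (by linarith)]
  have h2 : 1 - ρ * ‖a‖ ≤ ‖1 - (ρ : ℂ) * a‖ := by
    have := norm_sub_norm_le (1:ℂ) ((ρ : ℂ) * a)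
    rwa [norm_one, norm_mul, Complex.norm_real, Real.norm_of_nonneg hρ0] at this
  nlinarith

lemma lintegral_bump_mul_deriv_le {p α δ ε M : ℝ} (hα0 : 0 < α) (hα1 : α ≤ 1)
    (hδ0 : 0 < δ) (hδ1 : δ < 1) (hε : 0 ≤ ε) (hM : 0 ≤ M) {g : ℂ → ℂ}
    (hg : ∀ z ∈ ball (0:ℂ) 1, ‖deriv g z‖ ≤ M + ε * (1 - ‖z‖) ^ (α - 1))
    {r : ℝ} (hr0 : 0 ≤ r) (hr1 : r < 1) (θ : ℝ) :
    ∫⁻ s in Ioc (0 : ℝ) 1,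
      ‖bump p δ ((s : ℂ) * ((r : ℂ) * Complex.exp ((θ : ℂ) * Complex.I)))‖ₑ *
        ‖deriv g ((s : ℂ) * ((r : ℂ) * Complex.exp ((θ : ℂ) * Complex.I)))‖ₑ ≤
    ENNReal.ofReal (256 * δ ^ (4 - 1 / p) *
      (M * ‖1 - ((1 - δ : ℝ) : ℂ) * Complex.exp ((θ : ℂ) * Complex.I)‖ ^ (-3 : ℝ) +
      ε / α * ‖1 - ((1 - δ : ℝ) : ℂ) * Complex.exp ((θ : ℂ) * Complex.I)‖ ^ (α - 4))) := by
  set e := Complex.exp ((θ : ℂ) * Complex.I) with he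
  have hen : ‖e‖ = 1 := Complex.norm_exp_ofReal_mul_I θ
  set w := ‖1 - ((1 - δ : ℝ) : ℂ) * e‖ with hw
  have hxn : ‖((1 - δ : ℝ) : ℂ) * e‖ = 1 - δ := by
    rw [norm_mul, hen, Complex.norm_real, Real.norm_of_nonneg (by linarith), mul_one]
  have hwδ : δ ≤ w := by
    have := norm_sub_norm_le (1:ℂ) (((1 - δ : ℝ) : ℂ) * e)
    rw [hxn, norm_one] at this
    linarith
  have hw0 : 0 < w := hδ0.trans_le hwδ
  set h : ℝ → ℝ := fun s ↦ ‖1 - ((1 - δ : ℝ) : ℂ) * ((s : ℂ) * ((r : ℂ) * e))‖ with hh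
  have hform : ∀ s : ℝ, ((1 - δ : ℝ) : ℂ) * ((s : ℂ) * ((r : ℂ) * e))
      = ((s * r : ℝ) : ℂ) * (((1 - δ : ℝ) : ℂ) * e) := fun s ↦ by push_cast; ring
  have h1 : ∀ s ∈ Ioc (0 : ℝ) 1, w / 2 ≤ h s := by
    intro s hs
    simp only [hh, hform]
    exact norm_one_sub_le _ (mul_nonneg hs.1.le hr0) (by nlinarith [hs.1, hs.2])
      (by rw [hxn]; linarith)
  have h2 : ∀ s ∈ Ioc (0 : ℝ) 1, 1 - s ≤ h s := by
    intro s hs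
    simp only [hh, hform]
    have := norm_sub_norm_le (1:ℂ) (((s * r : ℝ) : ℂ) * (((1 - δ : ℝ) : ℂ) * e))
    rw [norm_one, norm_mul, hxn, Complex.norm_real,
      Real.norm_of_nonneg (mul_nonneg hs.1.le hr0)] at this
    have h3 : s * r * (1 - δ) ≤ s := by
      have : r * (1 - δ) ≤ 1 := by nlinarith
      nlinarith [hs.1]
    linarith
  have hD : 0 ≤ δ ^ (4 - 1 / p) := by positivity
  have hW : ∀ a : ℝ, Measurable fun s : ℝ ↦ ENNReal.ofReal ((1 - s) ^ (a - 1) * (h s ^ 4)⁻¹) := by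
    intro a
    have : Measurable h := by simp only [hh]; fun_prop
    fun_prop
  calc
    _ ≤ ∫⁻ s in Ioc (0 : ℝ) 1, (ENNReal.ofReal (δ ^ (4 - 1 / p) * M) *
          ENNReal.ofReal ((1 - s) ^ ((1:ℝ) - 1) * (h s ^ 4)⁻¹) +
        ENNReal.ofReal (δ ^ (4 - 1 / p) * ε) *
          ENNReal.ofReal ((1 - s) ^ (α - 1) * (h s ^ 4)⁻¹)) := by
      rw [← restrict_Ioo_eq_restrict_Ioc]
      refine lintegral_mono_ae ((ae_restrict_iff' measurableSet_Ioo).2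
        (Eventually.of_forall fun s hs ↦ ?_))
      have hx : 0 < 1 - s := by linarith [hs.2]
      have hzn : ‖(s : ℂ) * ((r : ℂ) * e)‖ = s * r := by
        rw [norm_mul, norm_mul, hen, Complex.norm_real, Complex.norm_real,
          Real.norm_of_nonneg hs.1.le, Real.norm_of_nonneg hr0, mul_one]
      have hsr : s * r ≤ s := by nlinarith [hs.1]
      have hz : (s : ℂ) * ((r : ℂ) * e) ∈ ball (0:ℂ) 1 := by
        rw [mem_ball_zero_iff, hzn]; linarith [hs.2]
      have hgz : ‖deriv g ((s : ℂ) * ((r : ℂ) * e))‖ ≤ M + ε * (1 - s) ^ (α - 1) := by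
        refine (hg _ hz).trans ?_
        rw [hzn]
        gcongr M + ε * ?_
        exact Real.rpow_le_rpow_of_nonpos hx (by linarith) (by linarith)
      have hb : ‖bump p δ ((s : ℂ) * ((r : ℂ) * e))‖ = δ ^ (4 - 1 / p) * (h s ^ 4)⁻¹ := by
        rw [bump, norm_mul, Complex.norm_real, Real.norm_of_nonneg hD, norm_inv, norm_pow]
      rw [← ofReal_norm, ← ofReal_norm,
        ← ENNReal.ofReal_mul (norm_nonneg _), ← ENNReal.ofReal_mul (by positivity),
        ← ENNReal.ofReal_mul (by positivity), ← ENNReal.ofReal_add (by positivity) (by positivity)]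
      refine ENNReal.ofReal_le_ofReal ?_
      rw [hb, sub_self, Real.rpow_zero]
      calc _ ≤ δ ^ (4 - 1 / p) * (h s ^ 4)⁻¹ * (M + ε * (1 - s) ^ (α - 1)) := by gcongr
        _ = _ := by ring
    _ = ENNReal.ofReal (δ ^ (4 - 1 / p) * M) *
          (∫⁻ s in Ioc (0 : ℝ) 1, ENNReal.ofReal ((1 - s) ^ ((1:ℝ) - 1) * (h s ^ 4)⁻¹)) +
        ENNReal.ofReal (δ ^ (4 - 1 / p) * ε) *
          ∫⁻ s in Ioc (0 : ℝ) 1, ENNReal.ofReal ((1 - s) ^ (α - 1) * (h s ^ 4)⁻¹) := by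
      rw [lintegral_add_left ((hW 1).const_mul _), lintegral_const_mul' _ _ ENNReal.ofReal_ne_top,
        lintegral_const_mul' _ _ ENNReal.ofReal_ne_top]
    _ ≤ ENNReal.ofReal (δ ^ (4 - 1 / p) * M) * ENNReal.ofReal (256 / 1 * w ^ ((1:ℝ) - 4)) +
        ENNReal.ofReal (δ ^ (4 - 1 / p) * ε) * ENNReal.ofReal (256 / α * w ^ (α - 4)) := by
      gcongr
      · exact lintegral_weight_le one_pos le_rfl hw0 h1 h2
      · exact lintegral_weight_le hα0 hα1 hw0 h1 h2
    _ = _ := by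
      rw [← ENNReal.ofReal_mul (by positivity), ← ENNReal.ofReal_mul (by positivity),
        ← ENNReal.ofReal_add (by positivity) (by positivity)]
      congr 1
      norm_num
      ring

lemma lintegral_norm_rpow_neg_le {δ β : ℝ} (hδ0 : 0 < δ) (hδ1 : δ < 1) (hβ : 2 ≤ β) :
    ∫⁻ θ in Ioc 0 (2 * π), ENNReal.ofReal
      (‖1 - ((1 - δ : ℝ) : ℂ) * Complex.exp ((θ : ℂ) * Complex.I)‖ ^ (-β)) ≤
      ENNReal.ofReal (2 * π * δ ^ (1 - β)) := by
  calc
    _ ≤ ∫⁻ θ in Ioc 0 (2 * π), ENNReal.ofReal (δ ^ (2 - β)) * ENNReal.ofReal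
        (‖1 - ((1 - δ : ℝ) : ℂ) * Complex.exp ((θ : ℂ) * Complex.I)‖ ^ (-2 : ℝ)) := by
      refine lintegral_mono fun θ ↦ ?_
      rw [← ENNReal.ofReal_mul (by positivity)]
      refine ENNReal.ofReal_le_ofReal ?_
      set w := ‖1 - ((1 - δ : ℝ) : ℂ) * Complex.exp ((θ : ℂ) * Complex.I)‖
      have hwδ : δ ≤ w := by
        have := norm_sub_norm_le (1:ℂ) (((1 - δ : ℝ) : ℂ) * Complex.exp ((θ : ℂ) * Complex.I))
        rw [norm_one, norm_mul, Complex.norm_exp_ofReal_mul_I, Complex.norm_real,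
          Real.norm_of_nonneg (by linarith)] at this
        linarith
      have hw0 : 0 < w := hδ0.trans_le hwδ
      calc w ^ (-β) = w ^ (2 - β) * w ^ (-2 : ℝ) := by
            rw [← Real.rpow_add hw0]; congr 1; ring
        _ ≤ _ := mul_le_mul_of_nonneg_right
          (Real.rpow_le_rpow_of_nonpos hδ0 hwδ (by linarith)) (by positivity)
    _ ≤ ENNReal.ofReal (δ ^ (2 - β)) * ENNReal.ofReal (2 * π / (1 - (1 - δ))) := by
      rw [lintegral_const_mul' _ _ ENNReal.ofReal_ne_top]
      gcongr
      exact lintegral_inv_norm_sq_le (by linarith) (by linarith)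
    _ = _ := by
      rw [← ENNReal.ofReal_mul (by positivity)]
      congr 1
      have : δ ^ (2 - β) = δ ^ (1 - β) * δ := by
        nth_rewrite 3 [← Real.rpow_one δ]
        rw [← Real.rpow_add hδ0]; congr 1; ring
      rw [this, sub_sub_cancel]
      field_simp

lemma add_rpow_le_two_rpow_mul {a b q : ℝ} (ha : 0 ≤ a) (hb : 0 ≤ b) (hq : 0 ≤ q) :
    (a + b) ^ q ≤ 2 ^ q * (a ^ q + b ^ q) := by
  calc (a + b) ^ q ≤ (2 * max a b) ^ q := by
        gcongr
        linarith [le_max_left a b, le_max_right a b]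
    _ = 2 ^ q * (max a b) ^ q := Real.mul_rpow (by norm_num) (by positivity)
    _ ≤ _ := by
      gcongr
      rcases max_choice a b with h | h <;> rw [h]
      · exact le_add_of_nonneg_right (by positivity)
      · exact le_add_of_nonneg_left (by positivity)

lemma lintegral_majorant_rpow_le {p q δ ε M : ℝ} (hp : 1 ≤ p) (hpq : p < q)
    (hα : 1 / p - 1 / q < 1) (hδ0 : 0 < δ) (hδ1 : δ < 1) (hε : 0 ≤ ε) (hM : 0 ≤ M) :
    ∫⁻ θ in Ioc 0 (2 * π), ENNReal.ofReal (256 * δ ^ (4 - 1 / p) *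
      (M * ‖1 - ((1 - δ : ℝ) : ℂ) * Complex.exp ((θ : ℂ) * Complex.I)‖ ^ (-3 : ℝ) +
      ε * ‖1 - ((1 - δ : ℝ) : ℂ) * Complex.exp ((θ : ℂ) * Complex.I)‖
        ^ ((1 / p - 1 / q) - 4))) ^ q ≤
    ENNReal.ofReal (512 ^ q * (2 * π) *
      (M ^ q * δ ^ (q * (1 - (1 / p - 1 / q))) + ε ^ q)) := by
  have hp0 : 0 < p := by linarith
  have hq0 : 0 < q := by linarith
  have hq1 : 1 < q := by linarith
  set α := 1 / p - 1 / q with hαdef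
  set w : ℝ → ℝ := fun θ ↦ ‖1 - ((1 - δ : ℝ) : ℂ) * Complex.exp ((θ : ℂ) * Complex.I)‖ with hw
  have hwm : Measurable w := by simp only [hw]; fun_prop
  have hw0 : ∀ θ, 0 ≤ w θ := fun θ ↦ norm_nonneg _
  set D := 512 ^ q * δ ^ (q * (4 - 1 / p)) with hD
  have hD0 : 0 ≤ D := by positivity
  calc
    _ ≤ ∫⁻ θ in Ioc 0 (2 * π), (ENNReal.ofReal (D * M ^ q) * ENNReal.ofReal (w θ ^ (-(3 * q))) +
        ENNReal.ofReal (D * ε ^ q) * ENNReal.ofReal (w θ ^ (-((4 - α) * q)))) := by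
      refine lintegral_mono fun θ ↦ ?_
      change ENNReal.ofReal (256 * δ ^ (4 - 1 / p) *
        (M * w θ ^ (-3 : ℝ) + ε * w θ ^ (α - 4))) ^ q ≤ _
      have := hw0 θ
      rw [ENNReal.ofReal_rpow_of_nonneg (by positivity) hq0.le,
        ← ENNReal.ofReal_mul (by positivity), ← ENNReal.ofReal_mul (by positivity),
        ← ENNReal.ofReal_add (by positivity) (by positivity)]
      refine ENNReal.ofReal_le_ofReal ?_
      rw [Real.mul_rpow (by positivity) (by positivity), Real.mul_rpow (by norm_num)
        (by positivity), ← Real.rpow_mul hδ0.le]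
      calc _ ≤ 256 ^ q * δ ^ ((4 - 1 / p) * q) *
            (2 ^ q * ((M * w θ ^ (-3 : ℝ)) ^ q + (ε * w θ ^ (α - 4)) ^ q)) := by
            gcongr
            exact add_rpow_le_two_rpow_mul (by positivity) (by positivity) hq0.le
        _ = _ := by
            rw [Real.mul_rpow hM (by positivity), Real.mul_rpow hε (by positivity),
              ← Real.rpow_mul (hw0 θ), ← Real.rpow_mul (hw0 θ), hD,
              show (512 : ℝ) = 256 * 2 by norm_num, Real.mul_rpow (by norm_num) (by norm_num)]
            rw [show (-3 : ℝ) * q = -(3 * q) by ring, show (α - 4) * q = -((4 - α) * q) by ring,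
              mul_comm (4 - 1 / p) q]
            ring
    _ ≤ ENNReal.ofReal (D * M ^ q) * ENNReal.ofReal (2 * π * δ ^ (1 - 3 * q)) +
        ENNReal.ofReal (D * ε ^ q) * ENNReal.ofReal (2 * π * δ ^ (1 - (4 - α) * q)) := by
      rw [lintegral_add_left (by fun_prop), lintegral_const_mul' _ _ ENNReal.ofReal_ne_top,
        lintegral_const_mul' _ _ ENNReal.ofReal_ne_top]
      gcongr
      · exact lintegral_norm_rpow_neg_le hδ0 hδ1 (by linarith)
      · exact lintegral_norm_rpow_neg_le hδ0 hδ1 (by nlinarith)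
    _ = _ := by
      rw [← ENNReal.ofReal_mul (by positivity), ← ENNReal.ofReal_mul (by positivity),
        ← ENNReal.ofReal_add (by positivity) (by positivity)]
      congr 1
      have e1 : δ ^ (q * (4 - 1 / p)) * δ ^ (1 - 3 * q) = δ ^ (q * (1 - α)) := by
        rw [← Real.rpow_add hδ0]; congr 1; rw [hαdef]; field_simp; ring
      have e2 : δ ^ (q * (4 - 1 / p)) * δ ^ (1 - (4 - α) * q) = 1 := by
        rw [← Real.rpow_add hδ0,
          show q * (4 - 1 / p) + (1 - (4 - α) * q) = 0 by rw [hαdef]; field_simp; ring,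
          Real.rpow_zero]
      calc _ = 512 ^ q * (2 * π) * (M ^ q * (δ ^ (q * (4 - 1 / p)) * δ ^ (1 - 3 * q)) +
            ε ^ q * (δ ^ (q * (4 - 1 / p)) * δ ^ (1 - (4 - α) * q))) := by rw [hD]; ring
        _ = _ := by rw [e1, e2, mul_one]

/-- For `g ∈ λ_α`, the images of the test functions under `V_g` are small in `H^q`. -/
lemma exists_small_majorant {p q : ℝ} (hp : 1 ≤ p) (hpq : p < q) (hα : 1 / p - 1 / q < 1)
    {g : ℂ → ℂ} (hg : DifferentiableOn ℂ g (ball (0:ℂ) 1))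
    (hlam : ∀ ε > (0:ℝ), ∃ r < (1:ℝ), ∀ z ∈ ball (0:ℂ) 1, r < ‖z‖ →
      (1 - ‖z‖) ^ (1 - (1 / p - 1 / q)) * ‖deriv g z‖ < ε) {η : ℝ} (hη : 0 < η) :
    ∃ δ₀ > 0, ∀ δ, 0 < δ → δ < δ₀ → δ < 1 → ∃ B : ℝ → ℝ≥0∞, Measurable B ∧
      (∀ r ∈ Ico (0:ℝ) 1, ∀ θ : ℝ, ∫⁻ s in Ioc (0 : ℝ) 1,
        ‖bump p δ ((s : ℂ) * ((r : ℂ) * Complex.exp ((θ : ℂ) * Complex.I)))‖ₑ *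
        ‖deriv g ((s : ℂ) * ((r : ℂ) * Complex.exp ((θ : ℂ) * Complex.I)))‖ₑ ≤ B θ) ∧
      ∫⁻ θ in Ioc 0 (2 * π), B θ ^ q ≤ ENNReal.ofReal η := by
  have hp0 : 0 < p := by linarith
  have hq0 : 0 < q := by linarith
  set α := 1 / p - 1 / q with hαdef
  have hα0 : 0 < α := by
    rw [hαdef, sub_pos]; exact one_div_lt_one_div_of_lt hp0 hpq
  set K : ℝ := 512 ^ q * (2 * π) with hK
  have hK0 : 0 < K := by positivity
  set t : ℝ := (η / (2 * K)) ^ (1 / q) with ht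
  have ht0 : 0 < t := by positivity
  have htq : t ^ q = η / (2 * K) := by
    rw [ht, ← Real.rpow_mul (by positivity), one_div_mul_cancel hq0.ne', Real.rpow_one]
  obtain ⟨M, hM0, hM⟩ := exists_norm_deriv_le hg hlam (mul_pos hα0 ht0)
  have hκ : 0 < q * (1 - α) := mul_pos hq0 (by linarith)
  have hMq : 0 ≤ M ^ q := by positivity
  refine ⟨(η / (2 * K * (M ^ q + 1))) ^ (1 / (q * (1 - α))), by positivity,
    fun δ hδ0 hδ hδ1 ↦ ⟨fun θ ↦ ENNReal.ofReal (256 * δ ^ (4 - 1 / p) *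
      (M * ‖1 - ((1 - δ : ℝ) : ℂ) * Complex.exp ((θ : ℂ) * Complex.I)‖ ^ (-3 : ℝ) +
      α * t / α * ‖1 - ((1 - δ : ℝ) : ℂ) * Complex.exp ((θ : ℂ) * Complex.I)‖ ^ (α - 4))),
      by fun_prop, fun r hr θ ↦ lintegral_bump_mul_deriv_le hα0 hα.le hδ0 hδ1 (by positivity)
        hM0 hM hr.1 hr.2 θ, ?_⟩⟩
  rw [mul_div_cancel_left₀ _ hα0.ne']
  refine (lintegral_majorant_rpow_le hp hpq hα hδ0 hδ1 ht0.le hM0).trans ?_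
  refine ENNReal.ofReal_le_ofReal ?_
  have hδκ : δ ^ (q * (1 - α)) ≤ η / (2 * K * (M ^ q + 1)) := by
    calc δ ^ (q * (1 - α)) ≤
          ((η / (2 * K * (M ^ q + 1))) ^ (1 / (q * (1 - α)))) ^ (q * (1 - α)) := by gcongr
      _ = _ := by
        rw [← Real.rpow_mul (by positivity), one_div_mul_cancel hκ.ne', Real.rpow_one]
  change K * (M ^ q * δ ^ (q * (1 - α)) + t ^ q) ≤ η
  rw [htq]
  have h1 : M ^ q * δ ^ (q * (1 - α)) ≤ η / (2 * K) := by
    calc M ^ q * δ ^ (q * (1 - α)) ≤ (M ^ q + 1) * (η / (2 * K * (M ^ q + 1))) := by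
          gcongr; linarith
      _ = _ := by field_simp
  calc K * (M ^ q * δ ^ (q * (1 - α)) + η / (2 * K)) ≤ K * (η / (2 * K) + η / (2 * K)) := by
        gcongr
    _ = η := by field_simp; ring

lemma ENNReal.tsum_rpow_le_tsum_two_pow_mul_rpow (b : ℕ → ℝ≥0∞) {q : ℝ} (hq : 0 < q) :
    (∑' k, b k) ^ q ≤ 2 ^ q * ∑' k, (2 ^ k * b k) ^ q := by
  set S := ∑' k, (2 ^ k * b k) ^ q with hS
  have h1 : ∀ k, b k ≤ 2⁻¹ ^ k * S ^ (1 / q) := by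
    intro k
    have h2 : (2 ^ k * b k) ^ q ≤ S := ENNReal.le_tsum k
    have h3 : 2 ^ k * b k ≤ S ^ (1 / q) := by rwa [one_div, ENNReal.le_rpow_inv_iff hq]
    calc b k = 2⁻¹ ^ k * (2 ^ k * b k) := by
          rw [← mul_assoc, ← mul_pow, ENNReal.inv_mul_cancel two_ne_zero ENNReal.ofNat_ne_top,
            one_pow, one_mul]
      _ ≤ _ := by gcongr
  calc (∑' k, b k) ^ q ≤ (∑' k, 2⁻¹ ^ k * S ^ (1 / q)) ^ q := by
        gcongr with k
        exact h1 k
    _ = _ := by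
      rw [ENNReal.tsum_mul_right, ENNReal.tsum_geometric, ENNReal.one_sub_inv_two, inv_inv,
        ENNReal.mul_rpow_of_nonneg _ _ hq.le, ← ENNReal.rpow_mul, one_div_mul_cancel hq.ne',
        ENNReal.rpow_one]

lemma norm_two_pow_mul_bump_le {p δ : ℝ} (hp : 1 ≤ p) {k : ℕ} (hδ0 : 0 < δ) (hδ1 : δ < 1)
    (hδk : δ ≤ (1 / 4) ^ k) {ρ : ℝ} (hρ : ρ < 1) {z : ℂ} (hz : ‖z‖ ≤ ρ) :
    ‖(2:ℂ) ^ k * bump p δ z‖ ≤ (1 / 2) ^ k * ((1 - ρ) ^ 4)⁻¹ := by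
  have hρ0 : 0 < 1 - ρ := by linarith
  have h1 : 1 - ρ ≤ ‖1 - ((1 - δ : ℝ) : ℂ) * z‖ := by
    have := norm_sub_norm_le (1:ℂ) (((1 - δ : ℝ) : ℂ) * z)
    rw [norm_one, norm_mul, Complex.norm_real, Real.norm_of_nonneg (by linarith)] at this
    nlinarith [norm_nonneg z]
  have h2 : δ ^ (4 - 1 / p) ≤ (1 / 4) ^ k := by
    refine le_trans ?_ hδk
    have : 1 / p ≤ 1 := by rw [div_le_one (by linarith)]; exact hp
    calc δ ^ (4 - 1 / p) ≤ δ ^ (1:ℝ) :=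
          Real.rpow_le_rpow_of_exponent_ge hδ0 hδ1.le (by linarith)
      _ = δ := Real.rpow_one δ
  rw [bump, norm_mul, norm_mul, Complex.norm_real, Real.norm_of_nonneg (by positivity), norm_inv,
    norm_pow, norm_pow, Complex.norm_ofNat]
  calc 2 ^ k * (δ ^ (4 - 1 / p) * (‖1 - ((1 - δ : ℝ) : ℂ) * z‖ ^ 4)⁻¹)
      ≤ 2 ^ k * ((1 / 4) ^ k * ((1 - ρ) ^ 4)⁻¹) := by gcongr
    _ = _ := by
      rw [← mul_assoc, ← mul_pow]; norm_num

lemma differentiableOn_tsum_bump {p : ℝ} (hp : 1 ≤ p) {δ : ℕ → ℝ} (hδ0 : ∀ k, 0 < δ k)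
    (hδ1 : ∀ k, δ k < 1) (hδk : ∀ k, δ k ≤ (1 / 4) ^ k) :
    DifferentiableOn ℂ (fun z ↦ ∑' k, (2:ℂ) ^ k * bump p (δ k) z) (ball 0 1) := by
  intro z hz
  have hz1 : ‖z‖ < 1 := by simpa using hz
  set ρ := (1 + ‖z‖) / 2 with hρ
  have hρ1 : ρ < 1 := by linarith
  have hzρ : z ∈ ball (0:ℂ) ρ := by rw [mem_ball_zero_iff]; linarith
  refine DifferentiableAt.differentiableWithinAt (DifferentiableOn.differentiableAt (s := ball 0 ρ)
    ?_ (isOpen_ball.mem_nhds hzρ))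
  refine Complex.differentiableOn_tsum_of_summable_norm
    (u := fun k : ℕ ↦ (1 / 2 : ℝ) ^ k * ((1 - ρ) ^ 4)⁻¹)
    (summable_geometric_two.mul_right _) (fun k ↦ ?_) isOpen_ball
    fun k w hw ↦ norm_two_pow_mul_bump_le hp (hδ0 k) (hδ1 k) (hδk k) hρ1
      (mem_ball_zero_iff.1 hw).le
  have hne : ∀ w ∈ ball (0:ℂ) ρ, (1 - ((1 - δ k : ℝ) : ℂ) * w) ^ 4 ≠ 0 := by
    intro w hw
    refine pow_ne_zero _ (sub_ne_zero.2 fun h ↦ ?_)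
    have h1 := congrArg norm h
    have hw' := mem_ball_zero_iff.1 hw
    rw [norm_one, norm_mul, Complex.norm_real,
      Real.norm_of_nonneg (by linarith [hδ1 k])] at h1
    nlinarith [hδ0 k, hδ1 k, norm_nonneg w]
  unfold bump
  exact (((DifferentiableOn.inv (by fun_prop) hne).const_mul _).const_mul _)

lemma le_norm_tsum_bump {p : ℝ} (hp : 1 ≤ p) {δ : ℕ → ℝ} (hδ0 : ∀ k, 0 < δ k)
    (hδ1 : ∀ k, δ k < 1) (hδk : ∀ k, δ k ≤ (1 / 4) ^ k) {y : ℝ} (hy0 : 0 ≤ y) (hy1 : y < 1)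
    (k : ℕ) :
    2 ^ k * (δ k ^ (4 - 1 / p) * ((1 - (1 - δ k) * y) ^ 4)⁻¹) ≤
      ‖∑' k, (2:ℂ) ^ k * bump p (δ k) (y : ℂ)‖ := by
  set F : ℕ → ℝ := fun k ↦ 2 ^ k * (δ k ^ (4 - 1 / p) * ((1 - (1 - δ k) * y) ^ 4)⁻¹) with hF
  have hFc : ∀ k, (2:ℂ) ^ k * bump p (δ k) (y : ℂ) = (F k : ℂ) := fun k ↦ by
    simp only [hF, bump]; push_cast; rfl
  have hF0 : ∀ k, 0 ≤ F k := fun k ↦ by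
    have := (hδ0 k).le
    simp only [hF]; positivity
  have hsum : Summable F := by
    refine Summable.of_nonneg_of_le hF0 (fun k ↦ ?_)
      (summable_geometric_two.mul_right ((1 - y) ^ 4)⁻¹)
    have := norm_two_pow_mul_bump_le hp (hδ0 k) (hδ1 k) (hδk k) hy1 (z := (y : ℂ))
      (by rw [Complex.norm_real, Real.norm_of_nonneg hy0])
    rwa [hFc, Complex.norm_real, Real.norm_of_nonneg (hF0 k)] at this
  simp only [hFc]
  rw [← Complex.ofReal_tsum, Complex.norm_real, Real.norm_of_nonneg (tsum_nonneg hF0)]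
  exact hsum.le_tsum k fun j _ ↦ hF0 j

lemma not_memHp_tsum_bump {p : ℝ} (hp : 1 ≤ p) {δ : ℕ → ℝ} (hδ0 : ∀ k, 0 < δ k)
    (hδ1 : ∀ k, δ k < 1) (hδk : ∀ k, δ k ≤ (1 / 4) ^ k) :
    ¬ memHp p (fun z ↦ ∑' k, (2:ℂ) ^ k * bump p (δ k) z) := by
  intro h
  obtain ⟨K, hK⟩ := h.norm_le hp (differentiableOn_tsum_bump hp hδ0 hδ1 hδk)
  obtain ⟨k, hk⟩ := pow_unbounded_of_one_lt (81 * K) (one_lt_two (α := ℝ))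
  have hd := hδ0 k
  have hd1 := hδ1 k
  have h1 := hK (1 - δ k) (by linarith) (by linarith)
  have h2 := (le_norm_tsum_bump hp hδ0 hδ1 hδk (y := (1 - δ k) ^ 2) (by positivity)
    (by nlinarith) k).trans h1
  rw [sub_sub_cancel] at h2
  set d := δ k
  have h3 : 0 < 1 - (1 - d) * (1 - d) ^ 2 := by nlinarith
  have h4 : 1 - (1 - d) * (1 - d) ^ 2 ≤ 3 * d := by nlinarith [mul_pos hd hd]
  have h5 : d ^ (4 - 1 / p) = d ^ 4 * d ^ (-(1 / p)) := by
    rw [← Real.rpow_natCast, ← Real.rpow_add hd]; congr 1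
  have h6 : 2 ^ k / 81 * d ^ (-(1 / p)) ≤ K * d ^ (-(1 / p)) := by
    calc 2 ^ k / 81 * d ^ (-(1 / p)) = 2 ^ k * (d ^ (4 - 1 / p) * ((3 * d) ^ 4)⁻¹) := by
          rw [h5]; field_simp; norm_num
      _ ≤ 2 ^ k * (d ^ (4 - 1 / p) * ((1 - (1 - d) * (1 - d) ^ 2) ^ 4)⁻¹) := by gcongr
      _ ≤ _ := h2
  have h7 := le_of_mul_le_mul_right h6 (by positivity)
  linarith

lemma enorm_Vg_tsum_le {p : ℝ} {δ : ℕ → ℝ} {g : ℂ → ℂ} {z : ℂ} (hz : ‖z‖ ≤ 1)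
    {b : ℕ → ℝ≥0∞} (hb : ∀ k, ∫⁻ s in Ioc (0 : ℝ) 1,
      ‖bump p (δ k) ((s : ℂ) * z)‖ₑ * ‖deriv g ((s : ℂ) * z)‖ₑ ≤ b k) :
    ‖Vg g (fun z ↦ ∑' k, (2:ℂ) ^ k * bump p (δ k) z) z‖ₑ ≤ ∑' k, 2 ^ k * b k := by
  have hm : ∀ k, Measurable fun s : ℝ ↦
      ‖bump p (δ k) ((s : ℂ) * z)‖ₑ * ‖deriv g ((s : ℂ) * z)‖ₑ := by
    intro k
    have h1 : Measurable (bump p (δ k)) := by unfold bump; fun_prop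
    have h2 := measurable_deriv g
    have h3 : Measurable fun s : ℝ ↦ (s : ℂ) * z := by fun_prop
    exact (h1.comp h3).enorm.mul (h2.comp h3).enorm
  have hz' : ‖z‖ₑ ≤ 1 := by
    rw [← ofReal_norm]; exact ENNReal.ofReal_le_one.2 hz
  rw [Vg, enorm_mul, intervalIntegral.integral_of_le zero_le_one]
  calc
    _ ≤ 1 * ∫⁻ s in Ioc (0 : ℝ) 1, ‖(∑' k, (2:ℂ) ^ k * bump p (δ k) ((s : ℂ) * z)) *
          deriv g ((s : ℂ) * z)‖ₑ := by
      gcongr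
      exact enorm_integral_le_lintegral_enorm _
    _ ≤ ∫⁻ s in Ioc (0 : ℝ) 1, ∑' k, 2 ^ k *
          (‖bump p (δ k) ((s : ℂ) * z)‖ₑ * ‖deriv g ((s : ℂ) * z)‖ₑ) := by
      rw [one_mul]
      refine lintegral_mono fun s ↦ ?_
      dsimp only
      rw [enorm_mul]
      calc _ ≤ (∑' k, ‖(2:ℂ) ^ k * bump p (δ k) ((s : ℂ) * z)‖ₑ) * ‖deriv g ((s : ℂ) * z)‖ₑ := by
            gcongr; exact enorm_tsum_le_tsum_enorm
        _ = _ := by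
            rw [← ENNReal.tsum_mul_right]
            congr 1 with k
            rw [enorm_mul, enorm_pow, mul_assoc, ← ofReal_norm (2:ℂ), Complex.norm_ofNat,
              ENNReal.ofReal_ofNat]
    _ = ∑' k, 2 ^ k * ∫⁻ s in Ioc (0 : ℝ) 1,
          ‖bump p (δ k) ((s : ℂ) * z)‖ₑ * ‖deriv g ((s : ℂ) * z)‖ₑ := by
      rw [lintegral_tsum fun k ↦ ((hm k).const_mul _).aemeasurable]
      congr 1 with k
      rw [lintegral_const_mul _ (hm k)]
    _ ≤ _ := by
      gcongr with k
      exact hb k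

lemma memHp_of_lintegral_le {q : ℝ} (hq : 0 ≤ q) {F : ℂ → ℂ} {C : ℝ≥0∞} (hC : C ≠ ∞)
    (h : ∀ r ∈ Ico (0:ℝ) 1, ∫⁻ θ in Ioc 0 (2 * π),
      ‖F ((r : ℂ) * Complex.exp ((θ : ℂ) * Complex.I))‖ₑ ^ q ≤ C) : memHp q F := by
  refine ⟨C.toReal, fun r hr ↦ ?_⟩
  rw [intervalIntegral.integral_of_le (by positivity)]
  refine (Real.le_norm_self _).trans ((norm_integral_le_lintegral_norm _).trans
    (ENNReal.toReal_mono hC (le_trans (lintegral_mono fun θ ↦ ?_) (h r hr))))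
  rw [Real.norm_of_nonneg (by positivity), ← ENNReal.ofReal_rpow_of_nonneg (norm_nonneg _) hq,
    ofReal_norm]

/-- Let `1 ≤ p < q < ∞` with `α = 1/p − 1/q < 1`, and let `g` be analytic on
`𝔻` with `(1−|z|)^{1−α}|g'(z)| → 0` as `|z| → 1⁻` (i.e. `g ∈ λ_α`). Then there is an
analytic `f` on `𝔻` with `f ∉ H^p` but `V_g f ∈ H^q`; that is, `H^p` is a proper subspace
of `[V_g, H^q]`. -/
theorem Hp_properSubset_optimalDomain_Hq
    (p q : ℝ) (hp : 1 ≤ p) (hpq : p < q) (hα : 1 / p - 1 / q < 1)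
    (g : ℂ → ℂ) (hg : DifferentiableOn ℂ g (ball (0:ℂ) 1))
    (hlam : ∀ ε > (0:ℝ), ∃ r < (1:ℝ), ∀ z ∈ ball (0:ℂ) 1, r < ‖z‖ →
      (1 - ‖z‖) ^ (1 - (1 / p - 1 / q)) * ‖deriv g z‖ < ε) :
    ∃ f : ℂ → ℂ, DifferentiableOn ℂ f (ball (0:ℂ) 1) ∧
      ¬ memHp p f ∧ memHp q (Vg g f) := by
  have hq0 : 0 < q := by linarith
  have hch : ∀ k : ℕ, ∃ δ : ℝ, ∃ B : ℝ → ℝ≥0∞, (0 < δ ∧ δ < 1 ∧ δ ≤ (1 / 4) ^ k) ∧ Measurable B ∧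
      (∀ r ∈ Ico (0:ℝ) 1, ∀ θ : ℝ, ∫⁻ s in Ioc (0 : ℝ) 1,
        ‖bump p δ ((s : ℂ) * ((r : ℂ) * Complex.exp ((θ : ℂ) * Complex.I)))‖ₑ *
        ‖deriv g ((s : ℂ) * ((r : ℂ) * Complex.exp ((θ : ℂ) * Complex.I)))‖ₑ ≤ B θ) ∧
      ∫⁻ θ in Ioc 0 (2 * π), B θ ^ q ≤ ENNReal.ofReal ((1 / 2) ^ k / (4 ^ k) ^ q) := by
    intro k
    obtain ⟨δ₀, hδ₀, h⟩ := exists_small_majorant hp hpq hα hg hlam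
      (η := (1 / 2) ^ k / (4 ^ k) ^ q) (by positivity)
    obtain ⟨δ, hδ0, hδ⟩ := exists_between
      (show (0:ℝ) < min δ₀ (min 1 ((1 / 4) ^ k)) by positivity)
    simp only [lt_min_iff] at hδ
    obtain ⟨B, hB⟩ := h δ hδ0 hδ.1 hδ.2.1
    exact ⟨δ, B, ⟨hδ0, hδ.2.1, hδ.2.2.le⟩, hB⟩
  choose δ B hδ hBm hB hBq using hch
  refine ⟨fun z ↦ ∑' k, (2:ℂ) ^ k * bump p (δ k) z,
    differentiableOn_tsum_bump hp (fun k ↦ (hδ k).1) (fun k ↦ (hδ k).2.1) fun k ↦ (hδ k).2.2,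
    not_memHp_tsum_bump hp (fun k ↦ (hδ k).1) (fun k ↦ (hδ k).2.1) fun k ↦ (hδ k).2.2,
    memHp_of_lintegral_le hq0.le (C := 2 ^ q * 2) ?_ fun r hr ↦ ?_⟩
  · exact ENNReal.mul_ne_top (ENNReal.rpow_ne_top_of_nonneg hq0.le ENNReal.ofNat_ne_top)
      ENNReal.ofNat_ne_top
  calc
    _ ≤ ∫⁻ θ in Ioc 0 (2 * π), 2 ^ q * ∑' k, (4 ^ k) ^ q * B k θ ^ q := by
      refine lintegral_mono fun θ ↦ ?_
      have hz : ‖(r : ℂ) * Complex.exp ((θ : ℂ) * Complex.I)‖ ≤ 1 := by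
        rw [norm_mul, Complex.norm_exp_ofReal_mul_I, Complex.norm_real,
          Real.norm_of_nonneg hr.1, mul_one]
        exact hr.2.le
      calc _ ≤ (∑' k, 2 ^ k * B k θ) ^ q :=
            ENNReal.rpow_le_rpow (enorm_Vg_tsum_le hz fun k ↦ hB k r hr θ) hq0.le
        _ ≤ 2 ^ q * ∑' k, (2 ^ k * (2 ^ k * B k θ)) ^ q :=
            ENNReal.tsum_rpow_le_tsum_two_pow_mul_rpow _ hq0
        _ = _ := by
            congr 2 with k
            rw [← mul_assoc, ← mul_pow, ENNReal.mul_rpow_of_nonneg _ _ hq0.le]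
            norm_num
    _ = 2 ^ q * ∑' k, (4 ^ k) ^ q * ∫⁻ θ in Ioc 0 (2 * π), B k θ ^ q := by
      have hm : ∀ k, Measurable fun θ ↦ B k θ ^ q := fun k ↦ (hBm k).pow_const q
      rw [lintegral_const_mul _ (Measurable.tsum fun k ↦ (hm k).const_mul _),
        lintegral_tsum fun k ↦ ((hm k).const_mul _).aemeasurable]
      congr 2 with k
      rw [lintegral_const_mul _ (hm k)]
    _ ≤ 2 ^ q * ∑' k : ℕ, 2⁻¹ ^ k := by
      gcongr with k
      calc _ ≤ ((4:ℝ≥0∞) ^ k) ^ q * ENNReal.ofReal ((1 / 2) ^ k / (4 ^ k) ^ q) := by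
            gcongr; exact hBq k
        _ = ENNReal.ofReal ((1 / 2) ^ k) := by
            have h4 : ((4:ℝ≥0∞) ^ k) ^ q = ENNReal.ofReal ((4 ^ k) ^ q) := by
              rw [← ENNReal.ofReal_rpow_of_nonneg (by positivity) hq0.le,
                ENNReal.ofReal_pow (by norm_num), ENNReal.ofReal_ofNat]
            rw [h4, ← ENNReal.ofReal_mul (by positivity)]
            congr 1
            field_simp
        _ = 2⁻¹ ^ k := by
            rw [ENNReal.ofReal_pow (by norm_num), one_div, ENNReal.ofReal_inv_of_pos two_pos,
              ENNReal.ofReal_ofNat]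
    _ = _ := by
      rw [ENNReal.tsum_geometric, ENNReal.one_sub_inv_two, inv_inv]
end

section
/- Let t ∈ [0,1) and γ > 0, and for f analytic on 𝔻 define (V_{g_t} f)(z) := ∫₀ᶻ f(ξ)/(1−tξ) dξ = z·∫₀¹ f(sz)/(1−tsz) ds. Then for every analytic f on 𝔻: (a) sup_{z∈𝔻}(1−|z|)^{γ}|(V_{g_t} f)(z)| < ∞ if and only if sup_{z∈𝔻}(1−|z|)^{γ+1}|f(z)| < ∞; and (b) (1−|z|)^{γ}|(V_{g_t} f)(z)| → 0 as |z| → 1⁻ if and only if (1−|z|)^{γ+1}|f(z)| → 0 as |z| → 1⁻. That is, [V_{g_t}, A^{−γ}] = A^{−(γ+1)} and [V_{g_t}, A_0^{−γ}] = A_0^{−(γ+1)}. -/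
open Metric

/-- The Volterra operator with symbol `g_t` (where `g_t'(z) = 1/(1−tz)`):
`(V_{g_t} f)(z) = ∫₀ᶻ f(ξ)/(1−tξ) dξ = z·∫₀¹ f(sz)/(1−tsz) ds`. -/
noncomputable def Vgt (t : ℝ) (f : ℂ → ℂ) (z : ℂ) : ℂ :=
  z * ∫ s in (0:ℝ)..1, f ((s : ℂ) * z) / (1 - (t : ℂ) * (s : ℂ) * z)

/-- `(1-|z|)^β·|f(z)| → 0` as `|z| → 1⁻`. -/
def vanishesAtBoundary (β : ℝ) (f : ℂ → ℂ) : Prop :=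
  ∀ ε > (0:ℝ), ∃ r < (1:ℝ), ∀ z ∈ ball (0:ℂ) 1,
    r < ‖z‖ → (1 - ‖z‖) ^ β * ‖f z‖ < ε

lemma one_sub_mul_norm_bounds {t : ℝ} (ht : t ∈ Set.Ico (0:ℝ) 1) {z : ℂ}
    (hz : z ∈ ball (0:ℂ) 1) : 1 - t ≤ ‖1 - (t:ℂ) * z‖ ∧ ‖1 - (t:ℂ) * z‖ ≤ 2 := by
  rw [mem_ball_zero_iff] at hz
  have hn : ‖(t:ℂ) * z‖ = t * ‖z‖ := by
    rw [norm_mul, Complex.norm_real, Real.norm_of_nonneg ht.1]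
  have hle : t * ‖z‖ ≤ t := mul_le_of_le_one_right ht.1 hz.le
  have h1 := norm_sub_norm_le (1:ℂ) ((t:ℂ) * z)
  have h2 := norm_sub_le (1:ℂ) ((t:ℂ) * z)
  rw [norm_one, hn] at h1 h2
  exact ⟨by linarith, by linarith [ht.2]⟩

lemma ofReal_mul_mem_unitBall {z : ℂ} (hz : z ∈ ball (0:ℂ) 1) {s : ℝ}
    (hs : s ∈ Set.Icc (0:ℝ) 1) : (s:ℂ) * z ∈ ball (0:ℂ) 1 := by
  rw [mem_ball_zero_iff] at hz ⊢
  rw [norm_mul, Complex.norm_real, Real.norm_of_nonneg hs.1]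
  exact (mul_le_of_le_one_left (norm_nonneg z) hs.2).trans_lt hz

lemma hasDerivAt_comp_ofReal_mul {F : ℂ → ℂ} {F' z : ℂ} {s : ℝ}
    (hF : HasDerivAt F F' ((s:ℂ) * z)) :
    HasDerivAt (fun x : ℝ => F ((x:ℂ) * z)) (z * F') s := by
  have hlin : HasDerivAt (fun w : ℂ => w * z) z (s:ℂ) := by
    simpa using (hasDerivAt_id (s:ℂ)).mul_const z
  rw [mul_comm z]
  exact (HasDerivAt.comp (s:ℂ) hF hlin).comp_ofReal

/-- `V_{g_t} f` is a primitive of `f(z) / (1 - t z)` on the unit disc. -/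
lemma hasDerivAt_Vgt {t : ℝ} (ht : t ∈ Set.Ico (0:ℝ) 1) {f : ℂ → ℂ}
    (hf : DifferentiableOn ℂ f (ball (0:ℂ) 1)) {z : ℂ} (hz : z ∈ ball (0:ℂ) 1) :
    HasDerivAt (Vgt t f) (f z / (1 - (t:ℂ) * z)) z := by
  have hd : DifferentiableOn ℂ (fun w => f w / (1 - (t:ℂ) * w)) (ball (0:ℂ) 1) := by
    refine hf.div (by fun_prop) fun w hw => ?_
    rw [← norm_pos_iff]
    linarith [(one_sub_mul_norm_bounds ht hw).1, ht.2]
  obtain ⟨F, hF0, hF⟩ := hd.isExactOn_ball.with_val_at 0 0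
  have heq : ∀ w ∈ ball (0:ℂ) 1, Vgt t f w = F w := by
    intro w hw
    have hcont : ContinuousOn
        (fun s : ℝ => w * (f ((s:ℂ) * w) / (1 - (t:ℂ) * ((s:ℂ) * w)))) (Set.uIcc 0 1) := by
      rw [Set.uIcc_of_le zero_le_one]
      exact continuousOn_const.mul (hd.continuousOn.comp
        (f := fun s : ℝ => (s:ℂ) * w) (by fun_prop) fun s hs => ofReal_mul_mem_unitBall hw hs)
    have hftc := intervalIntegral.integral_eq_sub_of_hasDerivAt
      (f := fun s : ℝ => F ((s:ℂ) * w)) (fun s hs => by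
        rw [Set.uIcc_of_le zero_le_one] at hs
        exact hasDerivAt_comp_ofReal_mul (hF _ (ofReal_mul_mem_unitBall hw hs)))
      hcont.intervalIntegrable
    rw [intervalIntegral.integral_const_mul] at hftc
    simpa [Vgt, hF0, mul_assoc] using hftc
  refine (hF z hz).congr_of_eventuallyEq ?_
  filter_upwards [isOpen_ball.mem_nhds hz] with w hw using heq w hw

/-- A growth bound on `V_{g_t} f` near the boundary yields one on `f`, by Cauchy's estimate. -/
lemma growth_le_of_growth_Vgt_le {t : ℝ} (ht : t ∈ Set.Ico (0:ℝ) 1) {γ : ℝ} (hγ : 0 < γ)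
    {f : ℂ → ℂ} (hf : DifferentiableOn ℂ f (ball (0:ℂ) 1)) {r C : ℝ}
    (hC : ∀ w ∈ ball (0:ℂ) 1, r < ‖w‖ → (1 - ‖w‖) ^ γ * ‖Vgt t f w‖ ≤ C)
    {z : ℂ} (hz : z ∈ ball (0:ℂ) 1) (hrz : (1 + 2 * r) / 3 < ‖z‖) :
    (1 - ‖z‖) ^ (γ + 1) * ‖f z‖ ≤ 2 ^ (γ + 2) * C := by
  have hz1 : ‖z‖ < 1 := by simpa using hz
  obtain ⟨R, hR⟩ : ∃ R, R = (1 - ‖z‖) / 2 := ⟨_, rfl⟩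
  have hRpos : 0 < R := by linarith
  have hRγ : 0 < R ^ γ := Real.rpow_pos_of_pos hRpos γ
  have hsub : closedBall z R ⊆ ball (0:ℂ) 1 := by
    intro w hw
    rw [mem_closedBall_iff_norm] at hw
    rw [mem_ball_zero_iff]
    linarith [norm_le_norm_add_norm_sub' w z]
  have hsphere : ∀ w ∈ sphere z R, ‖Vgt t f w‖ ≤ C / R ^ γ := by
    intro w hw
    have hwz : ‖w - z‖ = R := by simpa [dist_eq_norm] using hw
    have hle : R ≤ 1 - ‖w‖ := by linarith [norm_le_norm_add_norm_sub' w z]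
    have hr : r < ‖w‖ := by linarith [norm_le_norm_add_norm_sub w z]
    rw [le_div_iff₀ hRγ, mul_comm]
    exact (mul_le_mul_of_nonneg_right (Real.rpow_le_rpow hRpos.le hle hγ.le)
      (norm_nonneg _)).trans (hC w (hsub (sphere_subset_closedBall hw)) hr)
  have hV : DifferentiableOn ℂ (Vgt t f) (ball (0:ℂ) 1) := fun w hw =>
    (hasDerivAt_Vgt ht hf hw).differentiableAt.differentiableWithinAt
  have hcauchy := Complex.norm_deriv_le_of_forall_mem_sphere_norm_le hRpos
    (hV.diffContOnCl_ball hsub) hsphere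
  rw [(hasDerivAt_Vgt ht hf hz).deriv, norm_div] at hcauchy
  obtain ⟨hlow, hup⟩ := one_sub_mul_norm_bounds ht hz
  have hpos : 0 < ‖1 - (t:ℂ) * z‖ := by linarith [ht.2]
  rw [div_le_iff₀ hpos] at hcauchy
  have hC0 : 0 ≤ C / R ^ γ / R :=
    nonneg_of_mul_nonneg_left ((norm_nonneg _).trans hcauchy) hpos
  have hfz : ‖f z‖ ≤ C / R ^ γ / R * 2 :=
    hcauchy.trans (mul_le_mul_of_nonneg_left hup hC0)
  have hzR : 1 - ‖z‖ = 2 * R := by linarith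
  calc (1 - ‖z‖) ^ (γ + 1) * ‖f z‖
      ≤ (2 * R) ^ (γ + 1) * (C / R ^ γ / R * 2) := by
        rw [hzR]
        exact mul_le_mul_of_nonneg_left hfz (by positivity)
    _ = 2 ^ (γ + 2) * C := by
        rw [Real.mul_rpow two_pos.le hRpos.le, Real.rpow_add_one hRpos.ne',
          show γ + 2 = γ + 1 + 1 by ring, Real.rpow_add_one two_ne_zero (γ + 1)]
        field_simp

/-- A growth bound on `f` yields one on `V_{g_t} f`, by integration along radii. -/
lemma growth_Vgt_le_of_growth_le {t : ℝ} (ht : t ∈ Set.Ico (0:ℝ) 1) {γ : ℝ} (hγ : 0 < γ)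
    {f : ℂ → ℂ} (hf : DifferentiableOn ℂ f (ball (0:ℂ) 1)) {K C : ℝ} (hK : 0 ≤ K) (hC : 0 ≤ C)
    (hbound : ∀ w ∈ ball (0:ℂ) 1, ‖f w‖ ≤ K + C * (1 - ‖w‖) ^ (-(γ + 1)))
    {z : ℂ} (hz : z ∈ ball (0:ℂ) 1) :
    (1 - ‖z‖) ^ γ * ‖Vgt t f z‖ ≤ (1 - t)⁻¹ * (K * (1 - ‖z‖) ^ γ + C / γ) := by
  have hz1 : ‖z‖ < 1 := by simpa using hz
  have ht1 : 0 < 1 - t := by linarith [ht.2]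
  have hpos : ∀ s ∈ Set.Icc (0:ℝ) 1, 0 < 1 - s * ‖z‖ := fun s hs => by
    linarith [mul_le_of_le_one_left (norm_nonneg z) hs.2]
  have hφ : ∀ s ∈ Set.Icc (0:ℝ) 1, HasDerivAt (fun x : ℝ => Vgt t f ((x:ℂ) * z))
      (z * (f ((s:ℂ) * z) / (1 - (t:ℂ) * ((s:ℂ) * z)))) s := fun s hs =>
    hasDerivAt_comp_ofReal_mul (hasDerivAt_Vgt ht hf (ofReal_mul_mem_unitBall hz hs))
  have hB : ∀ s ∈ Set.Icc (0:ℝ) 1, HasDerivAt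
      (fun x : ℝ => (1 - t)⁻¹ * (K * (x * ‖z‖) + C / γ * (1 - x * ‖z‖) ^ (-γ)))
      ((1 - t)⁻¹ * (‖z‖ * (K + C * (1 - s * ‖z‖) ^ (-(γ + 1))))) s := by
    intro s hs
    have hlin : HasDerivAt (fun x : ℝ => x * ‖z‖) ‖z‖ s := by
      simpa using (hasDerivAt_id s).mul_const ‖z‖
    have hpow := (hlin.const_sub 1).rpow_const (p := -γ) (Or.inl (hpos s hs).ne')
    refine (((hlin.const_mul K).add (hpow.const_mul (C / γ))).const_mul (1 - t)⁻¹).congr_deriv ?_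
    rw [show -(γ + 1) = -γ - 1 by ring]
    field_simp
  have hmvt := image_norm_le_of_norm_deriv_right_le_deriv_boundary'
    (HasDerivAt.continuousOn hφ)
    (fun s hs => (hφ s (Set.Ico_subset_Icc_self hs)).hasDerivWithinAt)
    (by simp [Vgt]; positivity)
    (HasDerivAt.continuousOn hB)
    (fun s hs => (hB s (Set.Ico_subset_Icc_self hs)).hasDerivWithinAt)
    (fun s hs => by
      have hs' := Set.Ico_subset_Icc_self hs
      have hw := ofReal_mul_mem_unitBall hz hs'
      have hb := hbound _ hw
      have hn : ‖(s:ℂ) * z‖ = s * ‖z‖ := by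
        rw [norm_mul, Complex.norm_real, Real.norm_of_nonneg hs.1]
      rw [hn] at hb
      rw [norm_mul, norm_div, inv_mul_eq_div, mul_div_assoc]
      have h0 : 0 ≤ K + C * (1 - s * ‖z‖) ^ (-(γ + 1)) := (norm_nonneg _).trans hb
      exact mul_le_mul_of_nonneg_left
        (div_le_div₀ h0 hb ht1 (one_sub_mul_norm_bounds ht hw).1) (norm_nonneg z))
    (Set.right_mem_Icc.2 zero_le_one)
  have hzpos : 0 < 1 - ‖z‖ := by linarith
  simp only [Complex.ofReal_one, one_mul] at hmvt
  calc (1 - ‖z‖) ^ γ * ‖Vgt t f z‖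
      ≤ (1 - ‖z‖) ^ γ * ((1 - t)⁻¹ * (K * ‖z‖ + C / γ * (1 - ‖z‖) ^ (-γ))) := by
        gcongr
    _ = (1 - t)⁻¹ * (K * (1 - ‖z‖) ^ γ * ‖z‖ + C / γ) := by
        rw [Real.rpow_neg hzpos.le]
        have := (Real.rpow_pos_of_pos hzpos γ).ne'
        field_simp
    _ ≤ (1 - t)⁻¹ * (K * (1 - ‖z‖) ^ γ + C / γ) := by
        have := mul_le_of_le_one_right (mul_nonneg hK (Real.rpow_nonneg hzpos.le γ)) hz1.le
        gcongr

lemma le_mul_rpow_neg_of_rpow_mul_le {x β a C : ℝ} (hx : 0 < x) (h : x ^ β * a ≤ C) :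
    a ≤ C * x ^ (-β) := by
  rwa [Real.rpow_neg hx.le, ← div_eq_mul_inv, le_div_iff₀ (Real.rpow_pos_of_pos hx β), mul_comm]

lemma vanishesAtBoundary_Vgt_of_vanishesAtBoundary {t : ℝ} (ht : t ∈ Set.Ico (0:ℝ) 1) {γ : ℝ}
    (hγ : 0 < γ) {f : ℂ → ℂ} (hf : DifferentiableOn ℂ f (ball (0:ℂ) 1))
    (h : vanishesAtBoundary (γ + 1) f) : vanishesAtBoundary γ (Vgt t f) := by
  intro ε hε
  have ht1 : 0 < 1 - t := by linarith [ht.2]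
  obtain ⟨C, hCdef⟩ : ∃ C, C = ε / 2 * (1 - t) * γ := ⟨_, rfl⟩
  have hC : 0 < C := by rw [hCdef]; positivity
  obtain ⟨r, hr, hrC⟩ := h C hC
  obtain ⟨K, hK⟩ := (isCompact_closedBall (0:ℂ) r).exists_bound_of_continuousOn
    (hf.continuousOn.mono (closedBall_subset_ball hr))
  have hbound : ∀ w ∈ ball (0:ℂ) 1, ‖f w‖ ≤ max K 0 + C * (1 - ‖w‖) ^ (-(γ + 1)) := by
    intro w hw
    have hw1 : 0 < 1 - ‖w‖ := by
      rw [mem_ball_zero_iff] at hw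
      linarith
    rcases le_or_gt ‖w‖ r with hwr | hwr
    · exact le_add_of_le_of_nonneg ((hK w (by simpa using hwr)).trans (le_max_left _ _))
        (by positivity)
    · exact le_add_of_nonneg_of_le (le_max_right _ _)
        (le_mul_rpow_neg_of_rpow_mul_le hw1 (hrC w hw hwr).le)
  have hlim : Filter.Tendsto (fun x : ℝ => (1 - t)⁻¹ * (max K 0 * (1 - x) ^ γ + C / γ))
      (nhds 1) (nhds (ε / 2)) := by
    have hcont : ContinuousAt
        (fun x : ℝ => (1 - t)⁻¹ * (max K 0 * (1 - x) ^ γ + C / γ)) 1 := by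
      have hp : ContinuousAt (fun x : ℝ => (1 - x) ^ γ) 1 :=
        (continuousAt_const.sub continuousAt_id).rpow_const (Or.inr hγ.le)
      fun_prop
    convert hcont.tendsto using 2
    rw [sub_self, Real.zero_rpow hγ.ne', hCdef]
    field_simp
    ring
  obtain ⟨δ, hδ, hδε⟩ := Metric.eventually_nhds_iff.1 (hlim.eventually_lt_const (half_lt_self hε))
  refine ⟨1 - δ, by linarith, fun z hz hzδ => ?_⟩
  refine (growth_Vgt_le_of_growth_le ht hγ hf (le_max_right K 0) hC.le hbound hz).trans_lt (hδε ?_)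
  rw [mem_ball_zero_iff] at hz
  rw [Real.dist_eq, abs_lt]
  constructor <;> linarith

/-- For `t ∈ [0,1)` and `γ > 0`, and every analytic `f` on `𝔻`:
(a) `sup (1-|z|)^γ|(V_{g_t} f)(z)| < ∞` iff `sup (1-|z|)^{γ+1}|f(z)| < ∞`;
(b) `(1-|z|)^γ|(V_{g_t} f)(z)| → 0` iff `(1-|z|)^{γ+1}|f(z)| → 0` as `|z| → 1⁻`.
That is, `[V_{g_t}, A^{-γ}] = A^{-(γ+1)}` and `[V_{g_t}, A₀^{-γ}] = A₀^{-(γ+1)}`. -/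
theorem optimalDomain_Vgt_Korenblum
    (t : ℝ) (ht : t ∈ Set.Ico (0:ℝ) 1) (γ : ℝ) (hγ : 0 < γ) :
    ∀ f : ℂ → ℂ, DifferentiableOn ℂ f (ball (0:ℂ) 1) →
      ((∃ C : ℝ, ∀ z ∈ ball (0:ℂ) 1,
          (1 - ‖z‖) ^ γ * ‖Vgt t f z‖ ≤ C) ↔
        (∃ C : ℝ, ∀ z ∈ ball (0:ℂ) 1,
          (1 - ‖z‖) ^ (γ + 1) * ‖f z‖ ≤ C)) ∧
      (vanishesAtBoundary γ (Vgt t f) ↔ vanishesAtBoundary (γ + 1) f) := by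
  intro f hf
  refine ⟨⟨?_, ?_⟩, ?_, vanishesAtBoundary_Vgt_of_vanishesAtBoundary ht hγ hf⟩
  · rintro ⟨C, hC⟩
    refine ⟨2 ^ (γ + 2) * C, fun z hz => growth_le_of_growth_Vgt_le ht hγ hf (r := -1)
      (fun w hw _ => hC w hw) hz ?_⟩
    linarith [norm_nonneg z]
  · rintro ⟨C, hC⟩
    have hC0 : 0 ≤ C := by
      refine le_trans ?_ (hC 0 (by simp))
      simp
    refine ⟨(1 - t)⁻¹ * (C / γ), fun z hz => ?_⟩
    have hV := growth_Vgt_le_of_growth_le ht hγ hf le_rfl hC0 (fun w hw => by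
      rw [zero_add]
      refine le_mul_rpow_neg_of_rpow_mul_le ?_ (hC w hw)
      rw [mem_ball_zero_iff] at hw
      linarith) hz
    simpa using hV
  · intro h ε hε
    have h2 : (0:ℝ) < 2 ^ (γ + 2) := by positivity
    obtain ⟨r, hr, hrε⟩ := h (ε / 2 / 2 ^ (γ + 2)) (by positivity)
    refine ⟨(1 + 2 * r) / 3, by linarith, fun z hz hrz => ?_⟩
    have hle := growth_le_of_growth_Vgt_le ht hγ hf (fun w hw hw' => (hrε w hw hw').le) hz hrz
    rw [mul_div_cancel₀ _ h2.ne'] at hle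
    exact hle.trans_lt (half_lt_self hε)
end

section
/- For every γ > 0: (a) there exists an analytic f on 𝔻 with sup_{z∈𝔻}(1−|z|)^{γ}|f(z)| = ∞ but sup_{z∈𝔻}(1−|z|)^{γ}|(C₁ f)(z)| < ∞; and (b) there exists an analytic f on 𝔻 such that (1−|z|)^{γ}|(C₁ f)(z)| → 0 as |z| → 1⁻ while (1−|z|)^{γ}|f(z)| does not tend to 0 as |z| → 1⁻. That is, A^{−γ} is strictly contained in the optimal domain [C₁, A^{−γ}] of the Cesàro operator, and A_0^{−γ} is strictly contained in [C₁, A_0^{−γ}]. -/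
open Metric

/-- The classical Cesàro operator `(C₁ f)(z) = (1/z)∫₀ᶻ f(ξ)/(1−ξ) dξ = ∫₀¹ f(sz)/(1−sz) ds`. -/
noncomputable def cesaro (f : ℂ → ℂ) (z : ℂ) : ℂ :=
  ∫ s in (0:ℝ)..1, f ((s : ℂ) * z) / (1 - (s : ℂ) * z)

/-- The product of `1 - z` and the derivative of `z (1 + z)^{-β}`; its image under the Cesàro operator is
`(1 + z)^{-β}`. -/
noncomputable def cesaroPreimage (β : ℝ) (z : ℂ) : ℂ :=
  (1 - z) * ((1 + z) ^ ((-β : ℝ) : ℂ) + z * (((-β : ℝ) : ℂ) * (1 + z) ^ (((-β : ℝ) : ℂ) - 1)))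

lemma differentiableOn_cesaroPreimage (β : ℝ) :
    DifferentiableOn ℂ (cesaroPreimage β) (ball (0:ℂ) 1) := by
  have hpow (c : ℂ) : DifferentiableOn ℂ (fun z : ℂ => (1 + z) ^ c) (ball (0:ℂ) 1) := fun z hz =>
    (((differentiableAt_id.const_add 1).cpow_const
      (Complex.mem_slitPlane_of_norm_lt_one (mem_ball_zero_iff.1 hz)))).differentiableWithinAt
  exact (differentiableOn_id.const_sub 1).mul
    ((hpow _).add (differentiableOn_id.mul ((hpow _).const_mul _)))

lemma cesaro_cesaroPreimage (β : ℝ) {z : ℂ} (hz : ‖z‖ < 1) :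
    cesaro (cesaroPreimage β) z = (1 + z) ^ ((-β : ℝ) : ℂ) := by
  have hlt : ∀ s ∈ Set.uIcc (0:ℝ) 1, ‖(s : ℂ) * z‖ < 1 := by
    intro s hs
    rw [Set.uIcc_of_le zero_le_one] at hs
    rw [norm_mul, Complex.norm_real, Real.norm_of_nonneg hs.1]
    exact (mul_le_of_le_one_left (norm_nonneg z) hs.2).trans_lt hz
  have hmem : ∀ s ∈ Set.uIcc (0:ℝ) 1, 1 + (s : ℂ) * z ∈ Complex.slitPlane := fun s hs =>
    Complex.mem_slitPlane_of_norm_lt_one (hlt s hs)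
  have hne : ∀ s ∈ Set.uIcc (0:ℝ) 1, 1 - (s : ℂ) * z ≠ 0 := by
    intro s hs h
    have := hlt s hs
    rw [← sub_eq_zero.1 h, norm_one] at this
    exact lt_irrefl _ this
  have hcont : ContinuousOn
      (fun s : ℝ => cesaroPreimage β ((s : ℂ) * z) / (1 - (s : ℂ) * z)) (Set.uIcc 0 1) := by
    have hmul : ContinuousOn (fun s : ℝ => (s : ℂ) * z) (Set.uIcc 0 1) := by fun_prop
    exact ((differentiableOn_cesaroPreimage β).continuousOn.comp hmul
      fun s hs => mem_ball_zero_iff.2 (hlt s hs)).div (continuousOn_const.sub hmul) hne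
  have hderiv : ∀ s ∈ Set.uIcc (0:ℝ) 1, HasDerivAt
      (fun s : ℝ => (s : ℂ) * (1 + (s : ℂ) * z) ^ ((-β : ℝ) : ℂ))
      (cesaroPreimage β ((s : ℂ) * z) / (1 - (s : ℂ) * z)) s := by
    intro s hs
    have hlin : HasDerivAt (fun w : ℂ => 1 + w * z) z s := by
      simpa using ((hasDerivAt_id (s : ℂ)).mul_const z).const_add 1
    have h := ((hasDerivAt_id (s : ℂ)).mul
      (hlin.cpow_const (c := ((-β : ℝ) : ℂ)) (hmem s hs))).comp_ofReal
    refine h.congr_deriv ?_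
    rw [cesaroPreimage, mul_div_cancel_left₀ _ (hne s hs)]
    simp only [id]
    ring
  rw [cesaro, intervalIntegral.integral_eq_sub_of_hasDerivAt hderiv hcont.intervalIntegrable]
  simp

lemma norm_cesaro_cesaroPreimage_le {γ β : ℝ} (hβ : 0 ≤ β) {z : ℂ} (hz : ‖z‖ < 1) :
    (1 - ‖z‖) ^ γ * ‖cesaro (cesaroPreimage β) z‖ ≤ (1 - ‖z‖) ^ (γ - β) := by
  have hpos : 0 < 1 - ‖z‖ := sub_pos.2 hz
  have hle : 1 - ‖z‖ ≤ ‖1 + z‖ := by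
    have := norm_sub_norm_le (1 : ℂ) (-z)
    rwa [norm_one, norm_neg, sub_neg_eq_add] at this
  rw [cesaro_cesaroPreimage β hz, Complex.norm_cpow_real, sub_eq_add_neg γ β, Real.rpow_add hpos]
  exact mul_le_mul_of_nonneg_left
    (Real.rpow_le_rpow_of_nonpos hpos hle (neg_nonpos.2 hβ)) (Real.rpow_nonneg hpos.le _)

lemma le_norm_cesaroPreimage {β t : ℝ} (hβ : 0 ≤ β) (ht : 0 < t) (ht' : t ≤ 1 / 2) :
    β / 2 * t ^ (-β - 1) ≤ ‖cesaroPreimage β ((t - 1 : ℝ) : ℂ)‖ := by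
  have hval : cesaroPreimage β ((t - 1 : ℝ) : ℂ)
      = (((2 - t) * (t ^ (-β) + (1 - t) * (β * t ^ (-β - 1))) : ℝ) : ℂ) := by
    have hone : (1 : ℂ) + ((t - 1 : ℝ) : ℂ) = (t : ℂ) := by push_cast; ring
    have hexp : ((-β : ℝ) : ℂ) - 1 = ((-β - 1 : ℝ) : ℂ) := by push_cast; ring
    rw [cesaroPreimage, hone, hexp, ← Complex.ofReal_cpow ht.le, ← Complex.ofReal_cpow ht.le]
    push_cast
    ring
  rw [hval, Complex.norm_real]
  refine le_trans ?_ (le_abs_self _)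
  have hA : 0 ≤ t ^ (-β) := Real.rpow_nonneg ht.le _
  have hB : 0 ≤ β * t ^ (-β - 1) := mul_nonneg hβ (Real.rpow_nonneg ht.le _)
  nlinarith [mul_nonneg (sub_nonneg.2 ht') hA, mul_nonneg (sub_nonneg.2 ht') hB,
    mul_nonneg (mul_nonneg (sub_nonneg.2 ht') (sub_nonneg.2 ht')) hB]

lemma norm_ofReal_sub_one {t : ℝ} (ht : t ≤ 1 / 2) : ‖((t - 1 : ℝ) : ℂ)‖ = 1 - t := by
  rw [Complex.norm_real, Real.norm_of_nonpos (by linarith), neg_sub]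

lemma le_weight_mul_norm_cesaroPreimage {γ β t : ℝ} (hβ : 0 ≤ β) (ht : 0 < t) (ht' : t ≤ 1 / 2) :
    β / 2 * t ^ (-(β + 1 - γ)) ≤
      (1 - ‖((t - 1 : ℝ) : ℂ)‖) ^ γ * ‖cesaroPreimage β ((t - 1 : ℝ) : ℂ)‖ := by
  have hn : 1 - ‖((t - 1 : ℝ) : ℂ)‖ = t := by
    rw [norm_ofReal_sub_one ht', sub_sub_cancel]
  rw [hn, show -(β + 1 - γ) = γ + (-β - 1) by ring, Real.rpow_add ht]
  calc β / 2 * (t ^ γ * t ^ (-β - 1)) = t ^ γ * (β / 2 * t ^ (-β - 1)) := by ring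
    _ ≤ _ := mul_le_mul_of_nonneg_left (le_norm_cesaroPreimage hβ ht ht')
      (Real.rpow_nonneg ht.le _)

lemma not_bounded_cesaroPreimage {γ β : ℝ} (hβ : 0 < β) (hγβ : γ < β + 1) :
    ¬ ∃ C : ℝ, ∀ z ∈ ball (0:ℂ) 1, (1 - ‖z‖) ^ γ * ‖cesaroPreimage β z‖ ≤ C := by
  rintro ⟨C, hC⟩
  have htend := (tendsto_rpow_neg_nhdsGT_zero (neg_neg_of_pos (sub_pos.2 hγβ))).const_mul_atTop (half_pos hβ)
  have hev : ∀ᶠ t : ℝ in nhdsWithin 0 (Set.Ioi 0), 0 < t ∧ t < 1 / 2 :=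
    Ioo_mem_nhdsGT (by norm_num)
  obtain ⟨t, hCt, ht, ht'⟩ := ((htend.eventually_gt_atTop C).and hev).exists
  have hmem : ((t - 1 : ℝ) : ℂ) ∈ ball (0:ℂ) 1 := by
    rw [mem_ball_zero_iff, norm_ofReal_sub_one ht'.le]
    linarith
  exact (hCt.trans_le (le_weight_mul_norm_cesaroPreimage hβ.le ht ht'.le)).not_ge (hC _ hmem)

lemma not_vanishesAtBoundary_cesaroPreimage {γ β : ℝ} (hβ : 0 < β) (hγβ : γ ≤ β + 1) :
    ¬ vanishesAtBoundary γ (cesaroPreimage β) := by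
  intro h
  obtain ⟨r, hr, hlt⟩ := h (β / 2) (half_pos hβ)
  obtain ⟨t, ht, htmin⟩ := exists_between (lt_min (sub_pos.2 hr) (one_half_pos (α := ℝ)))
  obtain ⟨htr, ht'⟩ := lt_min_iff.1 htmin
  have hnorm := norm_ofReal_sub_one ht'.le
  have hsmall := hlt ((t - 1 : ℝ) : ℂ)
    (by rw [mem_ball_zero_iff, hnorm]; linarith) (by rw [hnorm]; linarith)
  have hone : 1 ≤ t ^ (-(β + 1 - γ)) :=
    Real.one_le_rpow_of_pos_of_le_one_of_nonpos ht (by linarith) (by linarith)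
  have := le_weight_mul_norm_cesaroPreimage (γ := γ) hβ.le ht ht'.le
  nlinarith

lemma vanishesAtBoundary_cesaro_cesaroPreimage {γ β : ℝ} (hβ : 0 ≤ β) (hβγ : β < γ) :
    vanishesAtBoundary γ (cesaro (cesaroPreimage β)) := by
  intro ε hε
  have hδ : 0 < γ - β := sub_pos.2 hβγ
  refine ⟨1 - ε ^ (γ - β)⁻¹, sub_lt_self _ (Real.rpow_pos_of_pos hε _), fun z hz hr => ?_⟩
  rw [mem_ball_zero_iff] at hz
  refine (norm_cesaro_cesaroPreimage_le hβ hz).trans_lt ?_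
  calc (1 - ‖z‖) ^ (γ - β) < (ε ^ (γ - β)⁻¹) ^ (γ - β) :=
        Real.rpow_lt_rpow (by linarith) (by linarith) hδ
    _ = ε := Real.rpow_inv_rpow hε.le (ne_of_gt hδ)

/-- For every `γ > 0`:
(a) there is an analytic `f` on `𝔻` with `(1-|z|)^γ|f(z)|` unbounded but
`(1-|z|)^γ|(C₁ f)(z)|` bounded on `𝔻`; and
(b) there is an analytic `f` on `𝔻` with `(1-|z|)^γ|(C₁ f)(z)| → 0` as `|z| → 1⁻` while
`(1-|z|)^γ|f(z)|` does not tend to `0`.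
That is, `A^{-γ} ⊊ [C₁, A^{-γ}]` and `A₀^{-γ} ⊊ [C₁, A₀^{-γ}]`. -/
theorem Korenblum_strict_in_optimalDomain_Cesaro
    (γ : ℝ) (hγ : 0 < γ) :
    (∃ f : ℂ → ℂ, DifferentiableOn ℂ f (ball (0:ℂ) 1) ∧
      (¬ ∃ C : ℝ, ∀ z ∈ ball (0:ℂ) 1, (1 - ‖z‖) ^ γ * ‖f z‖ ≤ C) ∧
      (∃ C : ℝ, ∀ z ∈ ball (0:ℂ) 1, (1 - ‖z‖) ^ γ * ‖cesaro f z‖ ≤ C)) ∧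
    (∃ f : ℂ → ℂ, DifferentiableOn ℂ f (ball (0:ℂ) 1) ∧
      vanishesAtBoundary γ (cesaro f) ∧ ¬ vanishesAtBoundary γ f) := by
  obtain ⟨β, hβmax, hβγ⟩ := exists_between (max_lt hγ (sub_one_lt γ))
  obtain ⟨hβ, hγβ⟩ := max_lt_iff.1 hβmax
  have hγβ' : γ < β + 1 := by linarith
  refine ⟨⟨cesaroPreimage β, differentiableOn_cesaroPreimage β,
      not_bounded_cesaroPreimage hβ hγβ', 1, fun z hz => ?_⟩,
    cesaroPreimage β, differentiableOn_cesaroPreimage β,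
      vanishesAtBoundary_cesaro_cesaroPreimage hβ.le hβγ,
      not_vanishesAtBoundary_cesaroPreimage hβ hγβ'.le⟩
  rw [mem_ball_zero_iff] at hz
  exact (norm_cesaro_cesaroPreimage_le hβ.le hz).trans
    (Real.rpow_le_one (by linarith) (by linarith [norm_nonneg z]) (by linarith))
end
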